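/- In the resolvent-sequence setting, if (H3) holds, then for every ε with 0 < ε < β/12: ∫_{5ε}^{β−5ε} |v³ₙ′|² dx → 0 and λₙ² ∫_{6ε}^{β−6ε} |v³ₙ|² dx → 0 as n → ∞. -/

import Mathlib

open Set Filter MeasureTheory

noncomputable section

/-- The resolvent-sequence setting for the locally damped Bresse system with
parameter `ℓ`: a sequence of nonzero frequencies `lam n` with `|lam n| → ∞`,
solutions `Uₙ = (v1,…,v6)` and right-hand sides `Fₙ = (f1,…,f6)` of the resolvent
equations `(lam n)^ℓ (i (lam n) I − 𝒜) Uₙ = Fₙ`, with `‖Uₙ‖_H = 1` and `‖Fₙ‖_H → 0`. -/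
structure BresseSetting (ρ₁ ρ₂ k₁ k₂ k₃ l L β a₀ : ℝ) (ℓ : ℕ) where
  lam : ℕ → ℝ
  v1 : ℕ → ℝ → ℂ
  v2 : ℕ → ℝ → ℂ
  v3 : ℕ → ℝ → ℂ
  v4 : ℕ → ℝ → ℂ
  v5 : ℕ → ℝ → ℂ
  v6 : ℕ → ℝ → ℂ
  f1 : ℕ → ℝ → ℂ
  f2 : ℕ → ℝ → ℂ
  f3 : ℕ → ℝ → ℂ
  f4 : ℕ → ℝ → ℂ
  f5 : ℕ → ℝ → ℂ
  f6 : ℕ → ℝ → ℂ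
  lam_ne : ∀ n, lam n ≠ 0
  lam_tendsto : Tendsto (fun n => |lam n|) atTop atTop
  reg_v1 : ∀ n, ContDiffOn ℝ 2 (v1 n) (Icc 0 L)
  reg_v3 : ∀ n, ContDiffOn ℝ 2 (v3 n) (Icc 0 L)
  reg_v5 : ∀ n, ContDiffOn ℝ 1 (v5 n) (Icc 0 L)
  reg_v5_left : ∀ n, ContDiffOn ℝ 2 (v5 n) (Icc 0 β)
  reg_v5_right : ∀ n, ContDiffOn ℝ 2 (v5 n) (Icc β L)
  reg_v2 : ∀ n, ContDiffOn ℝ 1 (v2 n) (Icc 0 L)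
  reg_v4 : ∀ n, ContDiffOn ℝ 1 (v4 n) (Icc 0 L)
  reg_v6 : ∀ n, ContDiffOn ℝ 1 (v6 n) (Icc 0 L)
  reg_f1 : ∀ n, ContDiffOn ℝ 1 (f1 n) (Icc 0 L)
  reg_f3 : ∀ n, ContDiffOn ℝ 1 (f3 n) (Icc 0 L)
  reg_f5 : ∀ n, ContDiffOn ℝ 1 (f5 n) (Icc 0 L)
  reg_f2 : ∀ n, ContinuousOn (f2 n) (Icc 0 L)
  reg_f4 : ∀ n, ContinuousOn (f4 n) (Icc 0 L)
  reg_f6 : ∀ n, ContinuousOn (f6 n) (Icc 0 L)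
  bc_zero : ∀ n, v1 n 0 = 0 ∧ v2 n 0 = 0 ∧ v3 n 0 = 0 ∧ v4 n 0 = 0 ∧ v5 n 0 = 0 ∧
      v6 n 0 = 0 ∧ f1 n 0 = 0 ∧ f3 n 0 = 0 ∧ f5 n 0 = 0
  bc_L : ∀ n, v1 n L = 0 ∧ v2 n L = 0 ∧ v3 n L = 0 ∧ v4 n L = 0 ∧ v5 n L = 0 ∧
      v6 n L = 0 ∧ f1 n L = 0 ∧ f3 n L = 0 ∧ f5 n L = 0
  eq1 : ∀ n, ∀ x ∈ Ioo (0 : ℝ) β ∪ Ioo β L,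
      Complex.I * (lam n : ℂ) * v1 n x - v2 n x = (lam n : ℂ) ^ (-(ℓ : ℤ)) * f1 n x
  eq2 : ∀ n, ∀ x ∈ Ioo (0 : ℝ) β ∪ Ioo β L,
      Complex.I * (lam n : ℂ) * (ρ₁ : ℂ) * v2 n x
        - (k₁ : ℂ) * deriv (fun y => deriv (v1 n) y + v3 n y + (l : ℂ) * v5 n y) x
        - (l : ℂ) * (k₃ : ℂ) * (deriv (v5 n) x - (l : ℂ) * v1 n x)
        = (ρ₁ : ℂ) * (lam n : ℂ) ^ (-(ℓ : ℤ)) * f2 n x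
  eq3 : ∀ n, ∀ x ∈ Ioo (0 : ℝ) β ∪ Ioo β L,
      Complex.I * (lam n : ℂ) * v3 n x - v4 n x = (lam n : ℂ) ^ (-(ℓ : ℤ)) * f3 n x
  eq4 : ∀ n, ∀ x ∈ Ioo (0 : ℝ) β ∪ Ioo β L,
      Complex.I * (lam n : ℂ) * (ρ₂ : ℂ) * v4 n x
        - (k₂ : ℂ) * deriv (deriv (v3 n)) x
        + (k₁ : ℂ) * (deriv (v1 n) x + v3 n x + (l : ℂ) * v5 n x)
        = (ρ₂ : ℂ) * (lam n : ℂ) ^ (-(ℓ : ℤ)) * f4 n x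
  eq5 : ∀ n, ∀ x ∈ Ioo (0 : ℝ) β ∪ Ioo β L,
      Complex.I * (lam n : ℂ) * v5 n x - v6 n x = (lam n : ℂ) ^ (-(ℓ : ℤ)) * f5 n x
  eq6 : ∀ n, ∀ x ∈ Ioo (0 : ℝ) β ∪ Ioo β L,
      Complex.I * (lam n : ℂ) * (ρ₁ : ℂ) * v6 n x
        - (k₃ : ℂ) * deriv (fun y => deriv (v5 n) y - (l : ℂ) * v1 n y) x
        + (l : ℂ) * (k₁ : ℂ) * (deriv (v1 n) x + v3 n x + (l : ℂ) * v5 n x)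
        + (if x < β then (a₀ : ℂ) else 0) * v6 n x
        = (ρ₁ : ℂ) * (lam n : ℂ) ^ (-(ℓ : ℤ)) * f6 n x
  normU : ∀ n, (∫ x in (0 : ℝ)..L,
      (k₁ * ‖deriv (v1 n) x + v3 n x + (l : ℂ) * v5 n x‖ ^ 2 + ρ₁ * ‖v2 n x‖ ^ 2
        + k₂ * ‖deriv (v3 n) x‖ ^ 2 + ρ₂ * ‖v4 n x‖ ^ 2
        + k₃ * ‖deriv (v5 n) x - (l : ℂ) * v1 n x‖ ^ 2 + ρ₁ * ‖v6 n x‖ ^ 2)) = 1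
  normF : Tendsto (fun n => ∫ x in (0 : ℝ)..L,
      (k₁ * ‖deriv (f1 n) x + f3 n x + (l : ℂ) * f5 n x‖ ^ 2 + ρ₁ * ‖f2 n x‖ ^ 2
        + k₂ * ‖deriv (f3 n) x‖ ^ 2 + ρ₂ * ‖f4 n x‖ ^ 2
        + k₃ * ‖deriv (f5 n) x - (l : ℂ) * f1 n x‖ ^ 2 + ρ₁ * ‖f6 n x‖ ^ 2))
      atTop (nhds 0)


/-- scalar sequences that are eventually bounded -/
def SB (c : ℕ → ℂ) : Prop := ∃ C : ℝ, ∀ᶠ n in atTop, ‖c n‖ ≤ C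

/-- sequences bounded in `L²(0,β)` -/
def BB (β : ℝ) (g : ℕ → ℝ → ℂ) : Prop :=
  (∀ n, ContinuousOn (g n) (Icc 0 β)) ∧ ∃ K : ℝ, ∀ᶠ n in atTop, (∫ x in (0:ℝ)..β, ‖g n x‖ ^ 2) ≤ K

/-- sequences tending to zero in `L²(0,β)` -/
def ZZ (β : ℝ) (g : ℕ → ℝ → ℂ) : Prop :=
  (∀ n, ContinuousOn (g n) (Icc 0 β)) ∧
    Tendsto (fun n => ∫ x in (0:ℝ)..β, ‖g n x‖ ^ 2) atTop (nhds 0)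

/-- sequences whose integral tends to zero -/
def OO (β : ℝ) (g : ℕ → ℝ → ℂ) : Prop :=
  (∀ n, ContinuousOn (g n) (Icc 0 β)) ∧
    Tendsto (fun n => ∫ x in (0:ℝ)..β, g n x) atTop (nhds 0)

/-- `a1` is the derivative of `a` -/
structure DD (β : ℝ) (a a1 : ℕ → ℝ → ℂ) : Prop where
  c0 : ∀ n, ContinuousOn (a n) (Icc 0 β)
  c1 : ∀ n, ContinuousOn (a1 n) (Icc 0 β)
  der : ∀ n, ∀ x ∈ Ioo 0 β, HasDerivAt (a n) (a1 n x) x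

lemma SB.const (c : ℂ) : SB (fun _ => c) := ⟨‖c‖, by simp⟩

lemma SB.of_tendsto {c : ℕ → ℂ} {a : ℂ} (h : Tendsto c atTop (nhds a)) : SB c := by
  refine ⟨‖a‖ + 1, ?_⟩
  have := h.norm.eventually (gt_mem_nhds (lt_add_one ‖a‖))
  filter_upwards [this] with n hn using hn.le

lemma SB.mul {c d : ℕ → ℂ} (h : SB c) (h' : SB d) : SB (fun n => c n * d n) := by
  obtain ⟨C, hC⟩ := h
  obtain ⟨D, hD⟩ := h'
  refine ⟨C * D, ?_⟩
  filter_upwards [hC, hD] with n h1 h2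
  rw [norm_mul]
  exact mul_le_mul h1 h2 (norm_nonneg _) ((norm_nonneg _).trans h1)

lemma sqi {β : ℝ} (hβ : 0 < β) {f : ℝ → ℂ} (h : ContinuousOn f (Icc 0 β)) :
    IntervalIntegrable (fun x => ‖f x‖ ^ 2) volume 0 β := by
  apply ContinuousOn.intervalIntegrable
  rw [uIcc_of_le hβ.le]
  exact h.norm.pow 2

lemma cii {β : ℝ} (hβ : 0 < β) {f : ℝ → ℂ} (h : ContinuousOn f (Icc 0 β)) :
    IntervalIntegrable f volume 0 β := by
  apply ContinuousOn.intervalIntegrable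
  rwa [uIcc_of_le hβ.le]

lemma sq_int_nonneg {β : ℝ} (hβ : 0 < β) (f : ℝ → ℂ) : 0 ≤ ∫ x in (0:ℝ)..β, ‖f x‖ ^ 2 :=
  intervalIntegral.integral_nonneg hβ.le (fun _ _ => by positivity)

lemma BB.congr {β : ℝ} (hβ : 0 < β) {f g : ℕ → ℝ → ℂ} (h : BB β f)
    (e : ∀ n, ∀ x ∈ Icc 0 β, g n x = f n x) : BB β g := by
  refine ⟨fun n => (h.1 n).congr (e n), ?_⟩
  obtain ⟨K, hK⟩ := h.2
  refine ⟨K, ?_⟩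
  filter_upwards [hK] with n hn
  rwa [intervalIntegral.integral_congr (g := fun x => ‖f n x‖ ^ 2)]
  intro x hx
  rw [uIcc_of_le hβ.le] at hx
  simp only [e n x hx]

lemma ZZ.congr {β : ℝ} (hβ : 0 < β) {f g : ℕ → ℝ → ℂ} (h : ZZ β f)
    (e : ∀ n, ∀ x ∈ Icc 0 β, g n x = f n x) : ZZ β g := by
  refine ⟨fun n => (h.1 n).congr (e n), ?_⟩
  refine h.2.congr (fun n => ?_)
  apply intervalIntegral.integral_congr
  intro x hx
  rw [uIcc_of_le hβ.le] at hx
  simp only [e n x hx]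

lemma OO.congr {β : ℝ} (hβ : 0 < β) {f g : ℕ → ℝ → ℂ} (h : OO β f)
    (e : ∀ n, ∀ x ∈ Icc 0 β, g n x = f n x) : OO β g := by
  refine ⟨fun n => (h.1 n).congr (e n), ?_⟩
  refine h.2.congr (fun n => ?_)
  apply intervalIntegral.integral_congr
  intro x hx
  rw [uIcc_of_le hβ.le] at hx
  simp only [e n x hx]

lemma ZZ.bb {β : ℝ} {f : ℕ → ℝ → ℂ} (h : ZZ β f) : BB β f := by
  refine ⟨h.1, 1, ?_⟩
  filter_upwards [h.2.eventually (gt_mem_nhds zero_lt_one)] with n hn using hn.le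

lemma sq_add_int {β : ℝ} (hβ : 0 < β) {f g : ℝ → ℂ} (hf : ContinuousOn f (Icc 0 β))
    (hg : ContinuousOn g (Icc 0 β)) :
    (∫ x in (0:ℝ)..β, ‖f x + g x‖ ^ 2) ≤
      2 * (∫ x in (0:ℝ)..β, ‖f x‖ ^ 2) + 2 * ∫ x in (0:ℝ)..β, ‖g x‖ ^ 2 := by
  rw [← intervalIntegral.integral_const_mul, ← intervalIntegral.integral_const_mul,
    ← intervalIntegral.integral_add ((sqi hβ hf).const_mul 2) ((sqi hβ hg).const_mul 2)]
  apply intervalIntegral.integral_mono_on hβ.le (sqi hβ (hf.add hg))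
    (((sqi hβ hf).const_mul 2).add ((sqi hβ hg).const_mul 2))
  intro x _
  simp only [Pi.add_apply]
  have := norm_add_le (f x) (g x)
  have h0 := norm_nonneg (f x + g x)
  nlinarith [sq_nonneg (‖f x‖ - ‖g x‖), norm_nonneg (f x), norm_nonneg (g x)]

lemma BB.add {β : ℝ} (hβ : 0 < β) {f g : ℕ → ℝ → ℂ} (hf : BB β f) (hg : BB β g) :
    BB β (fun n x => f n x + g n x) := by
  refine ⟨fun n => (hf.1 n).add (hg.1 n), ?_⟩
  obtain ⟨K, hK⟩ := hf.2
  obtain ⟨M, hM⟩ := hg.2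
  refine ⟨2 * K + 2 * M, ?_⟩
  filter_upwards [hK, hM] with n h1 h2
  have := sq_add_int hβ (hf.1 n) (hg.1 n)
  linarith

lemma ZZ.add {β : ℝ} (hβ : 0 < β) {f g : ℕ → ℝ → ℂ} (hf : ZZ β f) (hg : ZZ β g) :
    ZZ β (fun n x => f n x + g n x) := by
  refine ⟨fun n => (hf.1 n).add (hg.1 n), ?_⟩
  refine squeeze_zero (fun n => sq_int_nonneg hβ _)
    (fun n => sq_add_int hβ (hf.1 n) (hg.1 n)) ?_
  simpa using (hf.2.const_mul 2).add (hg.2.const_mul 2)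

lemma OO.add {β : ℝ} (hβ : 0 < β) {f g : ℕ → ℝ → ℂ} (hf : OO β f) (hg : OO β g) :
    OO β (fun n x => f n x + g n x) := by
  refine ⟨fun n => (hf.1 n).add (hg.1 n), ?_⟩
  have := hf.2.add hg.2
  rw [add_zero] at this
  refine this.congr (fun n => ?_)
  rw [intervalIntegral.integral_add (cii hβ (hf.1 n)) (cii hβ (hg.1 n))]

lemma BB.smul {β : ℝ} (hβ : 0 < β) {f : ℕ → ℝ → ℂ} (hf : BB β f) {c : ℕ → ℂ} (hc : SB c) :
    BB β (fun n x => c n * f n x) := by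
  refine ⟨fun n => continuousOn_const.mul (hf.1 n), ?_⟩
  obtain ⟨K, hK⟩ := hf.2
  obtain ⟨C, hC⟩ := hc
  refine ⟨C ^ 2 * K, ?_⟩
  filter_upwards [hK, hC] with n h1 h2
  simp only [norm_mul, mul_pow, intervalIntegral.integral_const_mul]
  have h3 : ‖c n‖ ^ 2 ≤ C ^ 2 := pow_le_pow_left₀ (norm_nonneg _) h2 2
  exact mul_le_mul h3 h1 (sq_int_nonneg hβ _) (by positivity)

lemma BB.smul_zz {β : ℝ} (hβ : 0 < β) {f : ℕ → ℝ → ℂ} (hf : BB β f) {c : ℕ → ℂ}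
    (hc : Tendsto c atTop (nhds 0)) :
    ZZ β (fun n x => c n * f n x) := by
  refine ⟨fun n => continuousOn_const.mul (hf.1 n), ?_⟩
  obtain ⟨K, hK⟩ := hf.2
  have h2 : Tendsto (fun n => ‖c n‖ ^ 2 * K) atTop (nhds 0) := by
    have := (hc.norm.pow 2).mul_const K
    simpa using this
  refine squeeze_zero' (Eventually.of_forall fun n => sq_int_nonneg hβ _) ?_ h2
  filter_upwards [hK] with n h1
  simp only [norm_mul, mul_pow, intervalIntegral.integral_const_mul]
  exact mul_le_mul_of_nonneg_left h1 (by positivity)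

lemma ZZ.smul {β : ℝ} (hβ : 0 < β) {f : ℕ → ℝ → ℂ} (hf : ZZ β f) {c : ℕ → ℂ} (hc : SB c) :
    ZZ β (fun n x => c n * f n x) := by
  refine ⟨fun n => continuousOn_const.mul (hf.1 n), ?_⟩
  obtain ⟨C, hC⟩ := hc
  have h2 : Tendsto (fun n => C ^ 2 * ∫ x in (0:ℝ)..β, ‖f n x‖ ^ 2) atTop (nhds 0) := by
    simpa using hf.2.const_mul (C ^ 2)
  refine squeeze_zero' (Eventually.of_forall fun n => sq_int_nonneg hβ _) ?_ h2
  filter_upwards [hC] with n h2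
  simp only [norm_mul, mul_pow, intervalIntegral.integral_const_mul]
  have h3 : ‖c n‖ ^ 2 ≤ C ^ 2 := pow_le_pow_left₀ (norm_nonneg _) h2 2
  exact mul_le_mul_of_nonneg_right h3 (sq_int_nonneg hβ _)

lemma OO.smul {β : ℝ} {f : ℕ → ℝ → ℂ} (hf : OO β f) {c : ℕ → ℂ} (hc : SB c) :
    OO β (fun n x => c n * f n x) := by
  refine ⟨fun n => continuousOn_const.mul (hf.1 n), ?_⟩
  obtain ⟨C, hC⟩ := hc
  have h2 : Tendsto (fun n => C * ‖∫ x in (0:ℝ)..β, f n x‖) atTop (nhds 0) := by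
    simpa using hf.2.norm.const_mul C
  refine squeeze_zero_norm' ?_ h2
  filter_upwards [hC] with n h2
  rw [intervalIntegral.integral_const_mul, norm_mul]
  exact mul_le_mul_of_nonneg_right h2 (norm_nonneg _)

lemma weight_le {β : ℝ} (hβ : 0 < β) {θ : ℝ → ℂ} (hθ : ContinuousOn θ (Icc 0 β)) :
    ∃ C : ℝ, 0 ≤ C ∧ ∀ g : ℝ → ℂ, ContinuousOn g (Icc 0 β) →
      (∫ x in (0:ℝ)..β, ‖θ x * g x‖ ^ 2) ≤ C * ∫ x in (0:ℝ)..β, ‖g x‖ ^ 2 := by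
  obtain ⟨C, hC⟩ := isCompact_Icc.exists_bound_of_continuousOn hθ
  refine ⟨C ^ 2, by positivity, fun g hg => ?_⟩
  rw [← intervalIntegral.integral_const_mul]
  apply intervalIntegral.integral_mono_on hβ.le (sqi hβ (hθ.mul hg)) ((sqi hβ hg).const_mul _)
  intro x hx
  simp only [Pi.mul_apply, norm_mul, mul_pow]
  exact mul_le_mul_of_nonneg_right (pow_le_pow_left₀ (norm_nonneg _) (hC x hx) 2) (by positivity)

lemma BB.weight {β : ℝ} (hβ : 0 < β) {f : ℕ → ℝ → ℂ} (hf : BB β f) {θ : ℝ → ℂ}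
    (hθ : ContinuousOn θ (Icc 0 β)) : BB β (fun n x => θ x * f n x) := by
  refine ⟨fun n => hθ.mul (hf.1 n), ?_⟩
  obtain ⟨K, hK⟩ := hf.2
  obtain ⟨C, hC0, hC⟩ := weight_le hβ hθ
  refine ⟨C * K, ?_⟩
  filter_upwards [hK] with n h1
  exact (hC _ (hf.1 n)).trans (mul_le_mul_of_nonneg_left h1 hC0)

lemma BB.conj {β : ℝ} {f : ℕ → ℝ → ℂ} (hf : BB β f) :
    BB β (fun n x => (starRingEnd ℂ) (f n x)) := by
  refine ⟨fun n => Complex.continuous_conj.comp_continuousOn (hf.1 n), ?_⟩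
  simpa using hf.2

lemma ZZ.conj {β : ℝ} {f : ℕ → ℝ → ℂ} (hf : ZZ β f) :
    ZZ β (fun n x => (starRingEnd ℂ) (f n x)) := by
  refine ⟨fun n => Complex.continuous_conj.comp_continuousOn (hf.1 n), ?_⟩
  simpa using hf.2

lemma DD.conj {β : ℝ} {a a1 : ℕ → ℝ → ℂ} (h : DD β a a1) :
    DD β (fun n x => (starRingEnd ℂ) (a n x)) (fun n x => (starRingEnd ℂ) (a1 n x)) where
  c0 n := Complex.continuous_conj.comp_continuousOn (h.c0 n)
  c1 n := Complex.continuous_conj.comp_continuousOn (h.c1 n)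
  der n x hx := by
    have := (h.der n x hx).star
    simpa using this

/-- Cauchy-Schwarz in AM-GM form -/
lemma cs_amgm {β : ℝ} (hβ : 0 < β) {f g : ℝ → ℂ} (hf : ContinuousOn f (Icc 0 β))
    (hg : ContinuousOn g (Icc 0 β)) {t : ℝ} (ht : 0 < t) :
    ‖∫ x in (0:ℝ)..β, f x * g x‖ ≤
      t⁻¹ * (∫ x in (0:ℝ)..β, ‖f x‖ ^ 2) + t * ∫ x in (0:ℝ)..β, ‖g x‖ ^ 2 := by
  refine (intervalIntegral.norm_integral_le_integral_norm hβ.le).trans ?_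
  rw [← intervalIntegral.integral_const_mul, ← intervalIntegral.integral_const_mul,
    ← intervalIntegral.integral_add ((sqi hβ hf).const_mul _) ((sqi hβ hg).const_mul _)]
  apply intervalIntegral.integral_mono_on hβ.le (cii hβ (hf.mul hg)).norm
    (((sqi hβ hf).const_mul _).add ((sqi hβ hg).const_mul _))
  intro x _
  rw [Pi.mul_apply, norm_mul]
  have h1 : t⁻¹ * ‖f x‖ ^ 2 + t * ‖g x‖ ^ 2 - 2 * (‖f x‖ * ‖g x‖)
      = t⁻¹ * (‖f x‖ - t * ‖g x‖) ^ 2 := by field_simp; ring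
  have h2 : 0 ≤ t⁻¹ * (‖f x‖ - t * ‖g x‖) ^ 2 := by positivity
  have h3 : 0 ≤ ‖f x‖ * ‖g x‖ := by positivity
  linarith

lemma ZZ.mul_bb {β : ℝ} (hβ : 0 < β) {f g : ℕ → ℝ → ℂ} (hf : ZZ β f) (hg : BB β g) :
    OO β (fun n x => f n x * g n x) := by
  refine ⟨fun n => (hf.1 n).mul (hg.1 n), ?_⟩
  obtain ⟨K, hK⟩ := hg.2
  rw [Metric.tendsto_atTop']
  have key : ∀ e > 0, ∀ᶠ n in atTop, dist (∫ x in (0:ℝ)..β, f n x * g n x) 0 < e := by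
    intro e he
    set M := |K| + 1 with hM
    have hM0 : 0 < M := by positivity
    set t := e / (2 * M) with ht
    have ht0 : 0 < t := by positivity
    have h1 := hf.2.eventually (gt_mem_nhds (show 0 < t * (e / 2) by positivity))
    filter_upwards [h1, hK] with n h1 h2
    rw [dist_zero_right]
    refine (cs_amgm hβ (hf.1 n) (hg.1 n) ht0).trans_lt ?_
    have h3 : t⁻¹ * (∫ x in (0:ℝ)..β, ‖f n x‖ ^ 2) < e / 2 := by
      rw [inv_mul_lt_iff₀ ht0]; exact h1
    have h4 : t * (∫ x in (0:ℝ)..β, ‖g n x‖ ^ 2) ≤ e / 2 := by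
      have : (∫ x in (0:ℝ)..β, ‖g n x‖ ^ 2) ≤ M := by
        have := le_abs_self K
        linarith
      calc t * (∫ x in (0:ℝ)..β, ‖g n x‖ ^ 2) ≤ t * M := mul_le_mul_of_nonneg_left this ht0.le
        _ = e / 2 := by rw [ht]; field_simp
    linarith
  intro e he
  obtain ⟨N, hN⟩ := eventually_atTop.1 (key e he)
  exact ⟨N, fun n hn => hN n hn.le⟩

lemma exact3 {β : ℝ} (hβ : 0 < β) {a a1 b b1 : ℕ → ℝ → ℂ} {θ θ1 : ℝ → ℂ} (c : ℕ → ℂ)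
    (ha : DD β a a1) (hb : DD β b b1) (hθ : DD β (fun _ => θ) (fun _ => θ1))
    (h0 : θ 0 = 0) (h1 : θ β = 0) :
    OO β (fun n x => c n * (a1 n x * θ x * b n x + a n x * θ1 x * b n x + a n x * θ x * b1 n x)) := by
  have hc : ∀ n, ContinuousOn (fun x => a1 n x * θ x * b n x + a n x * θ1 x * b n x
      + a n x * θ x * b1 n x) (Icc 0 β) := fun n =>
    ((((ha.c1 n).mul (hθ.c0 n)).mul (hb.c0 n)).add (((ha.c0 n).mul (hθ.c1 n)).mul (hb.c0 n))).add
      (((ha.c0 n).mul (hθ.c0 n)).mul (hb.c1 n))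
  refine ⟨fun n => continuousOn_const.mul (hc n), ?_⟩
  have : ∀ n, (∫ x in (0:ℝ)..β, c n * (a1 n x * θ x * b n x + a n x * θ1 x * b n x
      + a n x * θ x * b1 n x)) = 0 := by
    intro n
    rw [intervalIntegral.integral_const_mul]
    rw [intervalIntegral.integral_eq_sub_of_hasDerivAt_of_le hβ.le
      (f := fun x => a n x * θ x * b n x) (((ha.c0 n).mul (hθ.c0 n)).mul (hb.c0 n)) _ (cii hβ (hc n))]
    · simp [h0, h1]
    · intro x hx
      have := ((ha.der n x hx).mul (hθ.der n x hx)).mul (hb.der n x hx)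
      refine this.congr_deriv ?_
      simp only [Pi.mul_apply]
      ring
  simp [this]

lemma P2 {β : ℝ} (hβ : 0 < β) {Λ : ℕ → ℂ} (hΛ : ∀ n, Λ n ≠ 0) {w w1 h h1 : ℕ → ℝ → ℂ}
    {θ θ1 : ℝ → ℂ} (dw : DD β w w1) (hw : ZZ β (fun n x => Λ n ^ 3 * w n x))
    (dθ : DD β (fun _ => θ) (fun _ => θ1)) (t0 : θ 0 = 0) (t1 : θ β = 0)
    (dh : DD β h h1) (hh : BB β (fun n x => (Λ n)⁻¹ * h n x))
    (hh1 : BB β (fun n x => (Λ n)⁻¹ * h1 n x)) :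
    OO β (fun n x => Λ n ^ 2 * (w1 n x * θ x * h n x)) := by
  have e := exact3 hβ (fun n => Λ n ^ 2) dw dh dθ t0 t1
  have p1 := hw.mul_bb hβ (hh.weight hβ (dθ.c1 0))
  have p2 := hw.mul_bb hβ (hh1.weight hβ (dθ.c0 0))
  refine ((e.add hβ (p1.smul (SB.const (-1)))).add hβ (p2.smul (SB.const (-1)))).congr hβ ?_
  intro n x _
  have := hΛ n
  field_simp
  ring

lemma P0 {β : ℝ} (hβ : 0 < β) {Λ : ℕ → ℂ} (hΛ : ∀ n, Λ n ≠ 0)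
    (hT : Tendsto (fun n => (Λ n)⁻¹) atTop (nhds 0)) {w w1 h h1 : ℕ → ℝ → ℂ}
    {θ θ1 : ℝ → ℂ} (dw : DD β w w1) (hw : ZZ β (fun n x => Λ n ^ 3 * w n x))
    (dθ : DD β (fun _ => θ) (fun _ => θ1)) (t0 : θ 0 = 0) (t1 : θ β = 0)
    (dh : DD β h h1) (hh : BB β (fun n x => (Λ n)⁻¹ * h n x))
    (hh1 : BB β (fun n x => (Λ n)⁻¹ * h1 n x)) :
    OO β (fun n x => w1 n x * θ x * h n x) := by
  have e := P2 hβ hΛ dw hw dθ t0 t1 dh hh hh1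
  refine (e.smul ((SB.of_tendsto hT).mul (SB.of_tendsto hT))).congr hβ ?_
  intro n x _
  have := hΛ n
  field_simp

lemma core {β ρ₁ ρ₂ k₁ k₂ k₃ l a₀ : ℝ} (hβ : 0 < β)
    (hrho1 : 0 < ρ₁) (hrho2 : 0 < ρ₂) (hk1 : 0 < k₁) (hk2 : 0 < k₂) (hk3 : 0 < k₃) (hl : 0 < l)
    {Λ : ℕ → ℂ} (hΛ : ∀ n, Λ n ≠ 0) (hconj : ∀ n, (starRingEnd ℂ) (Λ n) = Λ n)
    (hT : Tendsto (fun n => (Λ n)⁻¹) atTop (nhds 0))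
    {u u1 u2 p p1 p2 w w1 w2 g2 g4 g6 : ℕ → ℝ → ℂ}
    (du : DD β u u1) (du1 : DD β u1 u2) (dp : DD β p p1) (dp1 : DD β p1 p2)
    (dw : DD β w w1) (dw1 : DD β w1 w2)
    (bu : BB β (fun n x => Λ n * u n x)) (bp : BB β (fun n x => Λ n * p n x))
    (zw : ZZ β (fun n x => Λ n ^ 3 * w n x))
    (bu1 : BB β u1) (bp1 : BB β p1) (bw1 : BB β w1)
    (zg2 : ZZ β g2) (zg4 : ZZ β g4) (zg6 : ZZ β (fun n x => Λ n * g6 n x))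
    (E2 : ∀ n, ∀ x ∈ Icc 0 β, -Λ n ^ 2 * ρ₁ * u n x - k₁ * (u2 n x + p1 n x + l * w1 n x)
      - l * k₃ * (w1 n x - l * u n x) = g2 n x)
    (E4 : ∀ n, ∀ x ∈ Icc 0 β, -Λ n ^ 2 * ρ₂ * p n x - k₂ * p2 n x
      + k₁ * (u1 n x + p n x + l * w n x) = g4 n x)
    (E6 : ∀ n, ∀ x ∈ Icc 0 β, -Λ n ^ 2 * ρ₁ * w n x - k₃ * (w2 n x - l * u1 n x)
      + l * k₁ * (u1 n x + p n x + l * w n x) + a₀ * (Complex.I * Λ n * w n x) = g6 n x)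
    {φ φ1 φ2 φ3 : ℝ → ℂ} (dφ : DD β (fun _ => φ) (fun _ => φ1))
    (dφ1 : DD β (fun _ => φ1) (fun _ => φ2)) (dφ2 : DD β (fun _ => φ2) (fun _ => φ3))
    (f00 : φ 0 = 0) (f01 : φ β = 0) (f10 : φ1 0 = 0) (f11 : φ1 β = 0)
    (f20 : φ2 0 = 0) (f21 : φ2 β = 0) :
    OO β (fun n x => Λ n ^ 2 * (p n x * φ x * (starRingEnd ℂ) (p n x))) ∧
    OO β (fun n x => p1 n x * φ x * (starRingEnd ℂ) (p1 n x)) := by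
  have c1 : (k₁ : ℂ) ≠ 0 := by exact_mod_cast hk1.ne'
  have c2 : (k₂ : ℂ) ≠ 0 := by exact_mod_cast hk2.ne'
  have c3 : (k₃ : ℂ) ≠ 0 := by exact_mod_cast hk3.ne'
  have cl : (l : ℂ) ≠ 0 := by exact_mod_cast hl.ne'
  have c13 : (k₁ : ℂ) + k₃ ≠ 0 := by exact_mod_cast (add_pos hk1 hk3).ne'
  have cD : (k₃ : ℂ) * ρ₂ + ρ₁ * k₂ ≠ 0 := by
    exact_mod_cast (add_pos (mul_pos hk3 hrho2) (mul_pos hrho1 hk2)).ne'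
  have sI : SB (fun n => (Λ n)⁻¹) := SB.of_tendsto hT
  -- basic consequences
  have zu : ZZ β u := (bu.smul_zz hβ hT).congr hβ fun n x _ => by
    have := hΛ n; field_simp
  have zp : ZZ β p := (bp.smul_zz hβ hT).congr hβ fun n x _ => by
    have := hΛ n; field_simp
  have zw2 : ZZ β (fun n x => Λ n ^ 2 * w n x) := (zw.smul hβ sI).congr hβ fun n x _ => by
    have := hΛ n; field_simp
  have zwl : ZZ β (fun n x => Λ n * w n x) := (zw2.smul hβ sI).congr hβ fun n x _ => by
    have := hΛ n; field_simp
  have zw0 : ZZ β w := (zwl.smul hβ sI).congr hβ fun n x _ => by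
    have := hΛ n; field_simp
  have zg6' : ZZ β g6 := (zg6.smul hβ sI).congr hβ fun n x _ => by
    have := hΛ n; field_simp
  have iu := zu.bb.smul hβ sI
  have ip := zp.bb.smul hβ sI
  have iw := zw0.bb.smul hβ sI
  have iu1 := bu1.smul hβ sI
  have ip1 := bp1.smul hβ sI
  have iw1 := bw1.smul hβ sI
  have iw2 : BB β (fun n x => (Λ n)⁻¹ * w2 n x) := by
    have h := (((((zwl.bb.smul hβ (SB.const (-(ρ₁:ℂ) / k₃))).add hβ
      (iu1.smul hβ (SB.const (((k₃:ℂ) * l + l * k₁) / k₃)))).add hβ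
      (ip.smul hβ (SB.const ((l:ℂ) * k₁ / k₃)))).add hβ
      (iw.smul hβ (SB.const ((l:ℂ) * k₁ * l / k₃)))).add hβ
      (zw0.bb.smul hβ (SB.const ((a₀:ℂ) * Complex.I / k₃)))).add hβ
      ((zg6'.bb.smul hβ sI).smul hβ (SB.const (-1 / (k₃:ℂ))))
    refine h.congr hβ fun n x hx => ?_
    have := hΛ n
    rw [← E6 n x hx]
    field_simp
    ring
  -- conjugates
  have dv := du.conj
  have dv1 := du1.conj
  have dq := dp.conj
  have dq1 := dp1.conj
  have dz := dw.conj
  have dz1 := dw1.conj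
  have ci : ∀ {f : ℕ → ℝ → ℂ}, BB β (fun n x => (Λ n)⁻¹ * f n x) →
      BB β (fun n x => (Λ n)⁻¹ * (starRingEnd ℂ) (f n x)) := by
    intro f hf
    refine hf.conj.congr hβ fun n x _ => ?_
    rw [map_mul, map_inv₀, hconj]
  have iv := ci iu
  have iv1 := ci iu1
  have iq := ci ip
  have iq1 := ci ip1
  have iz := ci iw
  have iz1 := ci iw1
  have iz2 := ci iw2
  have bq : BB β (fun n x => Λ n * (starRingEnd ℂ) (p n x)) :=
    bp.conj.congr hβ fun n x _ => by rw [map_mul, hconj]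
  have E2c : ∀ n, ∀ x ∈ Icc 0 β, -Λ n ^ 2 * ρ₁ * (starRingEnd ℂ) (u n x)
      - k₁ * ((starRingEnd ℂ) (u2 n x) + (starRingEnd ℂ) (p1 n x) + l * (starRingEnd ℂ) (w1 n x))
      - l * k₃ * ((starRingEnd ℂ) (w1 n x) - l * (starRingEnd ℂ) (u n x))
      = (starRingEnd ℂ) (g2 n x) := by
    intro n x hx
    rw [← E2 n x hx]
    simp only [map_sub, map_add, map_mul, map_neg, map_pow, hconj, Complex.conj_ofReal]
  have E4c : ∀ n, ∀ x ∈ Icc 0 β, -Λ n ^ 2 * ρ₂ * (starRingEnd ℂ) (p n x)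
      - k₂ * (starRingEnd ℂ) (p2 n x)
      + k₁ * ((starRingEnd ℂ) (u1 n x) + (starRingEnd ℂ) (p n x) + l * (starRingEnd ℂ) (w n x))
      = (starRingEnd ℂ) (g4 n x) := by
    intro n x hx
    rw [← E4 n x hx]
    simp only [map_sub, map_add, map_mul, map_neg, map_pow, hconj, Complex.conj_ofReal]
  have zg2c := zg2.conj
  have zg4c := zg4.conj
  have bv1 := bu1.conj
  have bq1 := bp1.conj
  have zq := zp.conj
  have zz := zw0.conj
  -- the remainder in the sixth equation
  have zr : ZZ β (fun n x => Λ n * ((l:ℂ) * (k₁ + k₃) * u1 n x + l * k₁ * p n x - k₃ * w2 n x)) := by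
    have h := (((zw.smul hβ (SB.const (ρ₁:ℂ))).add hβ
      (zwl.smul hβ (SB.const (-((l:ℂ) * l * k₁))))).add hβ
      (zw2.smul hβ (SB.const (-((a₀:ℂ) * Complex.I))))).add hβ zg6
    refine h.congr hβ fun n x hx => ?_
    linear_combination Λ n * E6 n x hx
  have zr0 : ZZ β (fun n x => (l:ℂ) * (k₁ + k₃) * u1 n x + l * k₁ * p n x - k₃ * w2 n x) :=
    (zr.smul hβ sI).congr hβ fun n x _ => by
      have := hΛ n; field_simp
  -- second derivatives
  have iq2 : BB β (fun n x => (Λ n)⁻¹ * (starRingEnd ℂ) (p2 n x)) := ci (by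
    have h := (((bp.smul hβ (SB.const (-(ρ₂:ℂ) / k₂))).add hβ
      (((iu1.add hβ ip).add hβ (iw.smul hβ (SB.const (l:ℂ)))).smul hβ
        (SB.const ((k₁:ℂ) / k₂)))).add hβ
      ((zg4.bb.smul hβ sI).smul hβ (SB.const (-1 / (k₂:ℂ)))))
    refine h.congr hβ fun n x hx => ?_
    have := hΛ n
    rw [← E4 n x hx]
    field_simp
    ring)
  have iv2 : BB β (fun n x => (Λ n)⁻¹ * (starRingEnd ℂ) (u2 n x)) := ci (by
    have h := ((((bu.smul hβ (SB.const (-(ρ₁:ℂ) / k₁))).add hβ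
      (ip1.smul hβ (SB.const (-1)))).add hβ
      (iw1.smul hβ (SB.const (-(l * (k₁ + k₃) : ℂ) / k₁)))).add hβ
      (iu.smul hβ (SB.const ((l * l * k₃ : ℂ) / k₁)))).add hβ
      ((zg2.bb.smul hβ sI).smul hβ (SB.const (-1 / (k₁:ℂ))))
    refine h.congr hβ fun n x hx => ?_
    have := hΛ n
    rw [← E2 n x hx]
    field_simp
    ring)
  -- pairings with `w1`
  have A1 := P2 hβ hΛ dw zw dφ1 f10 f11 dq iq iq1
  have A2 := P2 hβ hΛ dw zw dφ f00 f01 dq iq iq1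
  have A3 := P2 hβ hΛ dw zw dφ f00 f01 dq1 iq1 iq2
  have A4 := P2 hβ hΛ dw zw dφ f00 f01 dv iv iv1
  have B1 := P0 hβ hΛ hT dw zw dφ1 f10 f11 dq iq iq1
  have B3 := P0 hβ hΛ hT dw zw dφ f00 f01 dq1 iq1 iq2
  have B4 := P0 hβ hΛ hT dw zw dφ f00 f01 dv iv iv1
  have B5 := P0 hβ hΛ hT dw zw dφ2 f20 f21 dq1 iq1 iq2
  have B6 := P0 hβ hΛ hT dw zw dφ1 f10 f11 dv1 iv1 iv2
  have B7 := P0 hβ hΛ hT dw zw dφ1 f10 f11 dz iz iz1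
  have B8 := P0 hβ hΛ hT dw zw dφ f00 f01 dz1 iz1 iz2
  -- the sixth equation tested with `Λ² φ q`
  have o2 : OO β (fun n x => Λ n ^ 2 * (w2 n x * φ x * (starRingEnd ℂ) (p n x))) := by
    have e := exact3 hβ (fun n => Λ n ^ 2) dw1 dq dφ f00 f01
    refine ((e.add hβ (A1.smul (SB.const (-1)))).add hβ (A3.smul (SB.const (-1)))).congr hβ ?_
    intro n x _
    ring
  have o3 : OO β (fun n x => Λ n ^ 2 * (((k₁:ℂ) + k₃) * (u1 n x * φ x * (starRingEnd ℂ) (p n x))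
      + k₁ * (p n x * φ x * (starRingEnd ℂ) (p n x)))) := by
    have h := zr.mul_bb hβ (bq.weight hβ (dφ.c0 0))
    refine ((h.add hβ (o2.smul (SB.const (k₃:ℂ)))).smul (SB.const ((l:ℂ)⁻¹))).congr hβ ?_
    intro n x _
    field_simp
    ring
  -- `∫ u1 φ1 q1 → 0`
  have o4 : OO β (fun n x => u1 n x * φ1 x * (starRingEnd ℂ) (p1 n x)) := by
    have e := exact3 hβ (fun _ => 1) dw1 dq1 dφ1 f10 f11
    have h1 := zr0.mul_bb hβ (bq1.weight hβ (dφ1.c0 0))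
    have h2 := zp.mul_bb hβ (bq1.weight hβ (dφ1.c0 0))
    have h3 := zg4c.mul_bb hβ (bw1.weight hβ (dφ1.c0 0))
    -- `w2 φ1 q1`
    have h4 : OO β (fun n x => w2 n x * φ1 x * (starRingEnd ℂ) (p1 n x)) := by
      have hq2 : OO β (fun n x => w1 n x * φ1 x * (starRingEnd ℂ) (p2 n x)) := by
        refine (((((A1.smul (SB.const (-(ρ₂:ℂ) / k₂))).add hβ
          (B6.smul (SB.const ((k₁:ℂ) / k₂)))).add hβ
          (B1.smul (SB.const ((k₁:ℂ) / k₂)))).add hβ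
          (B7.smul (SB.const ((k₁:ℂ) * l / k₂)))).add hβ
          (h3.smul (SB.const (-1 / (k₂:ℂ))))).congr hβ ?_
        intro n x hx
        rw [← E4c n x hx]
        field_simp
        ring
      refine ((e.add hβ (B5.smul (SB.const (-1)))).add hβ (hq2.smul (SB.const (-1)))).congr hβ ?_
      intro n x _
      ring
    refine (((h1.add hβ (h2.smul (SB.const (-((l:ℂ) * k₁))))).add hβ
      (h4.smul (SB.const (k₃:ℂ)))).smul (SB.const (((l:ℂ) * (k₁ + k₃))⁻¹))).congr hβ ?_
    intro n x _
    field_simp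
    ring
  -- `∫ φ |u1|² → 0`
  have o5 : OO β (fun n x => u1 n x * φ x * (starRingEnd ℂ) (u1 n x)) := by
    have e := exact3 hβ (fun _ => 1) dw1 dv1 dφ f00 f01
    have h1 := zr0.mul_bb hβ (bv1.weight hβ (dφ.c0 0))
    have h2 := zp.mul_bb hβ (bv1.weight hβ (dφ.c0 0))
    have h3 := zg2c.mul_bb hβ (bw1.weight hβ (dφ.c0 0))
    have h4 : OO β (fun n x => w2 n x * φ x * (starRingEnd ℂ) (u1 n x)) := by
      have hv2 : OO β (fun n x => w1 n x * φ x * (starRingEnd ℂ) (u2 n x)) := by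
        refine (((((A4.smul (SB.const (-(ρ₁:ℂ) / k₁))).add hβ
          (B3.smul (SB.const (-1)))).add hβ
          (B8.smul (SB.const (-(l * (k₁ + k₃) : ℂ) / k₁)))).add hβ
          (B4.smul (SB.const ((l * l * k₃ : ℂ) / k₁)))).add hβ
          (h3.smul (SB.const (-1 / (k₁:ℂ))))).congr hβ ?_
        intro n x hx
        rw [← E2c n x hx]
        field_simp
        ring
      refine ((e.add hβ (B6.smul (SB.const (-1)))).add hβ (hv2.smul (SB.const (-1)))).congr hβ ?_
      intro n x _
      ring
    refine (((h1.add hβ (h2.smul (SB.const (-((l:ℂ) * k₁))))).add hβ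
      (h4.smul (SB.const (k₃:ℂ)))).smul (SB.const (((l:ℂ) * (k₁ + k₃))⁻¹))).congr hβ ?_
    intro n x _
    field_simp
    ring
  -- the second equation tested with the derivative of φ q
  have o6 : OO β (fun n x => Λ n ^ 2 * ρ₁ * (u1 n x * φ x * (starRingEnd ℂ) (p n x))
      + k₁ * (u1 n x * φ2 x * (starRingEnd ℂ) (p n x)
        + 2 * (u1 n x * φ1 x * (starRingEnd ℂ) (p1 n x))
        + u1 n x * φ x * (starRingEnd ℂ) (p2 n x))
      + k₁ * (p2 n x * φ x * (starRingEnd ℂ) (p n x))) := by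
    have e1 := exact3 hβ (fun n => Λ n ^ 2 * ρ₁) du dq dφ f00 f01
    have e2 := exact3 hβ (fun _ => (k₁:ℂ)) du1 dq dφ1 f10 f11
    have e3 := exact3 hβ (fun _ => (k₁:ℂ)) du1 dq1 dφ f00 f01
    have e4 := exact3 hβ (fun _ => (k₁:ℂ)) dp1 dq dφ f00 f01
    have bχ := (zq.bb.weight hβ (dφ1.c0 0)).add hβ (bq1.weight hβ (dφ.c0 0))
    have h1 := zu.mul_bb hβ bχ
    have h2 := zg2.mul_bb hβ bχ
    refine ((((((((e1.add hβ e2).add hβ e3).add hβ e4).add hβ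
      (B1.smul (SB.const ((k₁ + k₃ : ℂ) * l)))).add hβ
      (B3.smul (SB.const ((k₁ + k₃ : ℂ) * l)))).add hβ
      (h1.smul (SB.const (-(l * l * k₃ : ℂ))))).add hβ h2)).congr hβ ?_
    intro n x hx
    rw [← E2 n x hx]
    ring
  have o7 : OO β (fun n x => k₂ * (u1 n x * φ x * (starRingEnd ℂ) (p2 n x))
      + Λ n ^ 2 * ρ₂ * (u1 n x * φ x * (starRingEnd ℂ) (p n x))) := by
    have h1 := (((zq.add hβ (zz.smul hβ (SB.const (l:ℂ)))).smul hβ (SB.const (k₁:ℂ))).add hβ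
      (zg4c.smul hβ (SB.const (-1)))).mul_bb hβ (bu1.weight hβ (dφ.c0 0))
    refine (h1.add hβ (o5.smul (SB.const (k₁:ℂ)))).congr hβ ?_
    intro n x hx
    rw [← E4c n x hx]
    ring
  have bs : BB β (fun n x => k₁ * (u1 n x + p n x + l * w n x) + (-1) * g4 n x) :=
    (((bu1.add hβ zp.bb).add hβ (zw0.bb.smul hβ (SB.const (l:ℂ)))).smul hβ
      (SB.const (k₁:ℂ))).add hβ (zg4.bb.smul hβ (SB.const (-1)))
  have o8 : OO β (fun n x => k₂ * (p2 n x * φ x * (starRingEnd ℂ) (p n x))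
      + Λ n ^ 2 * ρ₂ * (p n x * φ x * (starRingEnd ℂ) (p n x))) := by
    refine (zq.mul_bb hβ (bs.weight hβ (dφ.c0 0))).congr hβ ?_
    intro n x hx
    rw [← E4 n x hx]
    ring
  have o10 : OO β (fun n x => Λ n ^ 2 * (p n x * φ x * (starRingEnd ℂ) (p n x))) := by
    have h1 := zq.mul_bb hβ (bu1.weight hβ (dφ2.c0 0))
    have o9 : OO β (fun n x => ((ρ₁:ℂ) * k₂ - k₁ * ρ₂) *
        (Λ n ^ 2 * (u1 n x * φ x * (starRingEnd ℂ) (p n x)))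
        - k₁ * ρ₂ * (Λ n ^ 2 * (p n x * φ x * (starRingEnd ℂ) (p n x)))) := by
      refine (((((o6.smul (SB.const (k₂:ℂ))).add hβ
        (h1.smul (SB.const (-(k₁ * k₂ : ℂ))))).add hβ
        (o4.smul (SB.const (-(2 * k₁ * k₂ : ℂ))))).add hβ
        (o7.smul (SB.const (-(k₁ : ℂ))))).add hβ (o8.smul (SB.const (-(k₁ : ℂ))))).congr hβ ?_
      intro n x _
      ring
    refine (((o9.smul (SB.const (k₁ + k₃ : ℂ))).add hβ
      (o3.smul (SB.const (-((ρ₁:ℂ) * k₂ - k₁ * ρ₂))))).smul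
      (SB.const (-(k₁ * ((k₃ : ℂ) * ρ₂ + ρ₁ * k₂))⁻¹))).congr hβ ?_
    intro n x _
    field_simp
    ring
  refine ⟨o10, ?_⟩
  have e := exact3 hβ (fun _ => 1) dp1 dq dφ f00 f01
  have h1 := zq.mul_bb hβ (bp1.weight hβ (dφ1.c0 0))
  refine (((e.add hβ (h1.smul (SB.const (-1)))).add hβ
    (o8.smul (SB.const (-(1 / k₂ : ℂ))))).add hβ
    (o10.smul (SB.const ((ρ₂ / k₂ : ℂ))))).congr hβ ?_
  intro n x _
  field_simp
  ring

lemma c1data {a b : ℝ} (hab : a < b) {f : ℝ → ℂ} (h : ContDiffOn ℝ 1 f (Icc a b)) :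
    ContinuousOn (derivWithin f (Icc a b)) (Icc a b) ∧
      ∀ x ∈ Ioo a b, HasDerivAt f (derivWithin f (Icc a b) x) x := by
  refine ⟨h.continuousOn_derivWithin (uniqueDiffOn_Icc hab) le_rfl, fun x hx => ?_⟩
  have h1 := (h.differentiableOn one_ne_zero) x ⟨hx.1.le, hx.2.le⟩
  exact h1.hasDerivWithinAt.hasDerivAt (Icc_mem_nhds hx.1 hx.2)

lemma c2data {a b : ℝ} (hab : a < b) {f : ℝ → ℂ} (h : ContDiffOn ℝ 2 f (Icc a b)) :
    ContDiffOn ℝ 1 (derivWithin f (Icc a b)) (Icc a b) :=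
  h.derivWithin (uniqueDiffOn_Icc hab) (by norm_num)

lemma int_congr_Ioo {E : Type*} [NormedAddCommGroup E] [NormedSpace ℝ E] {a b : ℝ} (hab : a ≤ b)
    {f g : ℝ → E} (h : ∀ x ∈ Ioo a b, f x = g x) :
    (∫ x in a..b, f x) = ∫ x in a..b, g x := by
  rw [intervalIntegral.integral_of_le hab, intervalIntegral.integral_of_le hab,
    integral_Ioc_eq_integral_Ioo, integral_Ioc_eq_integral_Ioo]
  exact setIntegral_congr_fun measurableSet_Ioo h

/-- boundedness of a primitive -/
lemma BB.primitive {β : ℝ} (hβ : 0 < β) {h h1 : ℕ → ℝ → ℂ} (d : DD β h h1)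
    (h0 : ∀ n, h n 0 = 0) (hb : BB β h1) : BB β h := by
  refine ⟨d.c0, ?_⟩
  obtain ⟨K, hK⟩ := hb.2
  refine ⟨β * (β + K) ^ 2, ?_⟩
  filter_upwards [hK] with n hn
  have hbd : ∀ x ∈ Icc 0 β, ‖h n x‖ ≤ β + K := by
    intro x hx
    have hsub : Icc 0 x ⊆ Icc 0 β := Icc_subset_Icc_right hx.2
    have e1 : (∫ y in (0:ℝ)..x, h1 n y) = h n x := by
      rw [intervalIntegral.integral_eq_sub_of_hasDerivAt_of_le hx.1 ((d.c0 n).mono hsub)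
        (fun y hy => d.der n y ⟨hy.1, hy.2.trans_le hx.2⟩)
        (by apply ContinuousOn.intervalIntegrable
            rw [uIcc_of_le hx.1]; exact (d.c1 n).mono hsub), h0, sub_zero]
    rw [← e1]
    have i1 : IntervalIntegrable (fun y => (1:ℝ) + ‖h1 n y‖ ^ 2) volume 0 β :=
      intervalIntegrable_const.add (sqi hβ (d.c1 n))
    calc ‖∫ y in (0:ℝ)..x, h1 n y‖ ≤ ∫ y in (0:ℝ)..x, ‖h1 n y‖ :=
          intervalIntegral.norm_integral_le_integral_norm hx.1
      _ ≤ ∫ y in (0:ℝ)..β, ‖h1 n y‖ := by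
          apply intervalIntegral.integral_mono_interval le_rfl hx.1 hx.2
          · exact Eventually.of_forall fun y => norm_nonneg _
          · exact (cii hβ (d.c1 n)).norm
      _ ≤ ∫ y in (0:ℝ)..β, ((1:ℝ) + ‖h1 n y‖ ^ 2) := by
          apply intervalIntegral.integral_mono_on hβ.le (cii hβ (d.c1 n)).norm i1
          intro y _
          nlinarith [sq_nonneg (‖h1 n y‖ - 1)]
      _ = β + ∫ y in (0:ℝ)..β, ‖h1 n y‖ ^ 2 := by
          rw [intervalIntegral.integral_add intervalIntegrable_const (sqi hβ (d.c1 n))]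
          simp
      _ ≤ β + K := by linarith
  calc (∫ x in (0:ℝ)..β, ‖h n x‖ ^ 2) ≤ ∫ x in (0:ℝ)..β, (β + K) ^ 2 := by
        apply intervalIntegral.integral_mono_on hβ.le (sqi hβ (d.c0 n)) intervalIntegrable_const
        intro x hx
        exact pow_le_pow_left₀ (norm_nonneg _) (hbd x hx) 2
    _ = β * (β + K) ^ 2 := by simp

lemma rot_bound {β l : ℝ} (hβ : 0 < β) {f g f' g' : ℕ → ℝ → ℂ} (df : DD β f f') (dg : DD β g g')
    (f0 : ∀ n, f n 0 = 0) (g0 : ∀ n, g n 0 = 0)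
    (h1 : BB β (fun n x => f' n x + l * g n x)) (h2 : BB β (fun n x => g' n x - l * f n x)) :
    BB β f ∧ BB β g := by
  let C : ℝ → ℂ := fun x => ((Real.cos (l * x) : ℝ) : ℂ)
  let D : ℝ → ℂ := fun x => ((Real.sin (l * x) : ℝ) : ℂ)
  have cC : ContinuousOn C (Icc 0 β) := by
    apply Continuous.continuousOn; fun_prop
  have cD : ContinuousOn D (Icc 0 β) := by
    apply Continuous.continuousOn; fun_prop
  have dC : ∀ x, HasDerivAt C (-(l : ℂ) * D x) x := by
    intro x
    have h := ((Real.hasDerivAt_cos (l * x)).comp x ((hasDerivAt_id x).const_mul l)).ofReal_comp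
    refine h.congr_deriv ?_
    simp [D, mul_comm]
  have dD : ∀ x, HasDerivAt D ((l : ℂ) * C x) x := by
    intro x
    have h := ((Real.hasDerivAt_sin (l * x)).comp x ((hasDerivAt_id x).const_mul l)).ofReal_comp
    refine h.congr_deriv ?_
    simp [C, mul_comm]
  have sq1 : ∀ x, C x * C x + D x * D x = 1 := by
    intro x
    have := Real.cos_sq_add_sin_sq (l * x)
    simp only [C, D]
    norm_cast
    nlinarith
  have b1 : BB β (fun n x => C x * (f' n x + l * g n x) + D x * (g' n x - l * f n x)) :=
    (h1.weight hβ cC).add hβ (h2.weight hβ cD)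
  have b2 : BB β (fun n x => (-D x) * (f' n x + l * g n x) + C x * (g' n x - l * f n x)) :=
    (h1.weight hβ cD.neg).add hβ (h2.weight hβ cC)
  have dP : DD β (fun n x => C x * f n x + D x * g n x)
      (fun n x => C x * (f' n x + l * g n x) + D x * (g' n x - l * f n x)) := by
    refine ⟨fun n => (cC.mul (df.c0 n)).add (cD.mul (dg.c0 n)), b1.1, fun n x hx => ?_⟩
    refine (((dC x).mul (df.der n x hx)).add ((dD x).mul (dg.der n x hx))).congr_deriv ?_
    ring
  have dQ : DD β (fun n x => (-D x) * f n x + C x * g n x)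
      (fun n x => (-D x) * (f' n x + l * g n x) + C x * (g' n x - l * f n x)) := by
    refine ⟨fun n => (cD.neg.mul (df.c0 n)).add (cC.mul (dg.c0 n)), b2.1, fun n x hx => ?_⟩
    refine (((dD x).neg.mul (df.der n x hx)).add ((dC x).mul (dg.der n x hx))).congr_deriv ?_
    simp only [Pi.neg_apply]
    ring
  have BP := BB.primitive hβ dP (fun n => by simp [f0, g0]) b1
  have BQ := BB.primitive hβ dQ (fun n => by simp [f0, g0]) b2
  constructor
  · refine ((BP.weight hβ cC).add hβ (BQ.weight hβ cD.neg)).congr hβ fun n x _ => ?_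
    simp only [Pi.neg_apply]
    linear_combination (-f n x) * sq1 x
  · refine ((BP.weight hβ cD).add hβ (BQ.weight hβ cC)).congr hβ fun n x _ => ?_
    linear_combination (-g n x) * sq1 x

lemma energy {ρ₁ ρ₂ k₁ k₂ k₃ l L β a₀ lm μ : ℝ}
    (hrho1 : 0 < ρ₁) (hrho2 : 0 < ρ₂) (hk1 : 0 < k₁) (hk2 : 0 < k₂) (hk3 : 0 < k₃)
    (hβ : 0 < β) (hβL : β < L) (hμ : 0 < μ)
    {S T N S1 T1 N1 v2 v4 v6 d2 d4 d6 Sf Tf Nf f2 f4 f6 : ℝ → ℂ}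
    (cS : ContinuousOn S (Icc 0 L)) (cT : ContinuousOn T (Icc 0 L)) (cN : ContinuousOn N (Icc 0 L))
    (c2 : ContinuousOn v2 (Icc 0 L)) (c4 : ContinuousOn v4 (Icc 0 L))
    (c6 : ContinuousOn v6 (Icc 0 L))
    (cSf : ContinuousOn Sf (Icc 0 L)) (cTf : ContinuousOn Tf (Icc 0 L))
    (cNf : ContinuousOn Nf (Icc 0 L))
    (cf2 : ContinuousOn f2 (Icc 0 L)) (cf4 : ContinuousOn f4 (Icc 0 L))
    (cf6 : ContinuousOn f6 (Icc 0 L))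
    (hS : ∀ x ∈ Ioo 0 β ∪ Ioo β L, HasDerivAt S (S1 x) x)
    (hT : ∀ x ∈ Ioo 0 β ∪ Ioo β L, HasDerivAt T (T1 x) x)
    (hN : ∀ x ∈ Ioo 0 β ∪ Ioo β L, HasDerivAt N (N1 x) x)
    (h2 : ∀ x ∈ Ioo 0 β ∪ Ioo β L, HasDerivAt v2 (d2 x) x)
    (h4 : ∀ x ∈ Ioo 0 β ∪ Ioo β L, HasDerivAt v4 (d4 x) x)
    (h6 : ∀ x ∈ Ioo 0 β ∪ Ioo β L, HasDerivAt v6 (d6 x) x)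
    (e2 : ∀ x ∈ Ioo 0 β ∪ Ioo β L, Complex.I * lm * ρ₁ * v2 x - k₁ * S1 x - l * k₃ * N x
      = ρ₁ * μ * f2 x)
    (e4 : ∀ x ∈ Ioo 0 β ∪ Ioo β L, Complex.I * lm * ρ₂ * v4 x - k₂ * T1 x + k₁ * S x
      = ρ₂ * μ * f4 x)
    (e6 : ∀ x ∈ Ioo 0 β ∪ Ioo β L, Complex.I * lm * ρ₁ * v6 x - k₃ * N1 x + l * k₁ * S x
      + (if x < β then (a₀ : ℂ) else 0) * v6 x = ρ₁ * μ * f6 x)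
    (r2 : ∀ x ∈ Ioo 0 β ∪ Ioo β L, d2 x + v4 x + l * v6 x = Complex.I * lm * S x - μ * Sf x)
    (r4 : ∀ x ∈ Ioo 0 β ∪ Ioo β L, d4 x = Complex.I * lm * T x - μ * Tf x)
    (r6 : ∀ x ∈ Ioo 0 β ∪ Ioo β L, d6 x - l * v2 x = Complex.I * lm * N x - μ * Nf x)
    (z20 : v2 0 = 0) (z40 : v4 0 = 0) (z60 : v6 0 = 0)
    (z2L : v2 L = 0) (z4L : v4 L = 0) (z6L : v6 L = 0) {t : ℝ} (ht : 0 < t) :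
    a₀ * (∫ x in (0:ℝ)..β, ‖v6 x‖ ^ 2) ≤ μ * (t * (∫ x in (0:ℝ)..L,
      (k₁ * ‖S x‖ ^ 2 + ρ₁ * ‖v2 x‖ ^ 2 + k₂ * ‖T x‖ ^ 2 + ρ₂ * ‖v4 x‖ ^ 2
        + k₃ * ‖N x‖ ^ 2 + ρ₁ * ‖v6 x‖ ^ 2)) + t⁻¹ * (∫ x in (0:ℝ)..L,
      (k₁ * ‖Sf x‖ ^ 2 + ρ₁ * ‖f2 x‖ ^ 2 + k₂ * ‖Tf x‖ ^ 2 + ρ₂ * ‖f4 x‖ ^ 2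
        + k₃ * ‖Nf x‖ ^ 2 + ρ₁ * ‖f6 x‖ ^ 2))) := by
  have hL : 0 < L := hβ.trans hβL
  let R : ℝ → ℝ := fun x => (k₁ * (S x * (starRingEnd ℂ) (Sf x)) + ρ₁ * (f2 x * (starRingEnd ℂ) (v2 x))
    + k₂ * (T x * (starRingEnd ℂ) (Tf x)) + ρ₂ * (f4 x * (starRingEnd ℂ) (v4 x))
    + k₃ * (N x * (starRingEnd ℂ) (Nf x)) + ρ₁ * (f6 x * (starRingEnd ℂ) (v6 x))).re
  let G : ℝ → ℂ := fun x => k₁ * (S x * (starRingEnd ℂ) (v2 x)) + k₂ * (T x * (starRingEnd ℂ) (v4 x))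
    + k₃ * (N x * (starRingEnd ℂ) (v6 x))
  have cj : ∀ {f : ℝ → ℂ}, ContinuousOn f (Icc 0 L) →
      ContinuousOn (fun x => (starRingEnd ℂ) (f x)) (Icc 0 L) := fun hf =>
    Complex.continuous_conj.comp_continuousOn hf
  have cR : ContinuousOn R (Icc 0 L) := by
    apply Complex.continuous_re.comp_continuousOn
    exact (((((continuousOn_const.mul (cS.mul (cj cSf))).add
      (continuousOn_const.mul (cf2.mul (cj c2)))).add
      (continuousOn_const.mul (cT.mul (cj cTf)))).add
      (continuousOn_const.mul (cf4.mul (cj c4)))).add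
      (continuousOn_const.mul (cN.mul (cj cNf)))).add
      (continuousOn_const.mul (cf6.mul (cj c6)))
  have cG : ContinuousOn G (Icc 0 L) :=
    ((continuousOn_const.mul (cS.mul (cj c2))).add (continuousOn_const.mul (cT.mul (cj c4)))).add
      (continuousOn_const.mul (cN.mul (cj c6)))
  have cGr : ContinuousOn (fun x => (G x).re) (Icc 0 L) :=
    Complex.continuous_re.comp_continuousOn cG
  have dG : ∀ x ∈ Ioo 0 β ∪ Ioo β L, HasDerivAt (fun x => (G x).re)
      ((if x < β then a₀ else 0) * ‖v6 x‖ ^ 2 - μ * R x) x := by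
    intro x hx
    have q2 : HasDerivAt (fun x => (starRingEnd ℂ) (v2 x)) ((starRingEnd ℂ) (d2 x)) x := by
      simpa using (h2 x hx).star
    have q4 : HasDerivAt (fun x => (starRingEnd ℂ) (v4 x)) ((starRingEnd ℂ) (d4 x)) x := by
      simpa using (h4 x hx).star
    have q6 : HasDerivAt (fun x => (starRingEnd ℂ) (v6 x)) ((starRingEnd ℂ) (d6 x)) x := by
      simpa using (h6 x hx).star
    have hG := ((((hS x hx).mul q2).const_mul (k₁ : ℂ)).add
      (((hT x hx).mul q4).const_mul (k₂ : ℂ))).add (((hN x hx).mul q6).const_mul (k₃ : ℂ))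
    have hGr := Complex.reCLM.hasFDerivAt.comp_hasDerivAt x hG
    refine hGr.congr_deriv ?_
    have E2 := e2 x hx
    have E4 := e4 x hx
    have E6 := e6 x hx
    have R2 := congrArg (starRingEnd ℂ) (r2 x hx)
    have R4 := congrArg (starRingEnd ℂ) (r4 x hx)
    have R6 := congrArg (starRingEnd ℂ) (r6 x hx)
    simp only [map_sub, map_add, map_mul, Complex.conj_ofReal, Complex.conj_I] at R2 R4 R6
    have key : k₁ * (S1 x * (starRingEnd ℂ) (v2 x) + S x * (starRingEnd ℂ) (d2 x))
        + k₂ * (T1 x * (starRingEnd ℂ) (v4 x) + T x * (starRingEnd ℂ) (d4 x))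
        + k₃ * (N1 x * (starRingEnd ℂ) (v6 x) + N x * (starRingEnd ℂ) (d6 x))
        = Complex.I * (lm * (ρ₁ * (v2 x * (starRingEnd ℂ) (v2 x))
          + ρ₂ * (v4 x * (starRingEnd ℂ) (v4 x)) + ρ₁ * (v6 x * (starRingEnd ℂ) (v6 x))
          - k₁ * (S x * (starRingEnd ℂ) (S x)) - k₂ * (T x * (starRingEnd ℂ) (T x))
          - k₃ * (N x * (starRingEnd ℂ) (N x))))
          + (if x < β then (a₀ : ℂ) else 0) * (v6 x * (starRingEnd ℂ) (v6 x))
          - μ * (k₁ * (S x * (starRingEnd ℂ) (Sf x)) + ρ₁ * (f2 x * (starRingEnd ℂ) (v2 x))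
    + k₂ * (T x * (starRingEnd ℂ) (Tf x)) + ρ₂ * (f4 x * (starRingEnd ℂ) (v4 x))
    + k₃ * (N x * (starRingEnd ℂ) (Nf x)) + ρ₁ * (f6 x * (starRingEnd ℂ) (v6 x))) := by
      linear_combination (-(starRingEnd ℂ) (v2 x)) * E2 - (starRingEnd ℂ) (v4 x) * E4
        - (starRingEnd ℂ) (v6 x) * E6 + k₁ * S x * R2 + k₂ * T x * R4 + k₃ * N x * R6
    have hif : (if x < β then (a₀ : ℂ) else 0) = ((if x < β then a₀ else 0 : ℝ) : ℂ) := by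
      split_ifs <;> simp
    rw [hif] at key
    simp only [Complex.mul_conj] at key
    rw [Complex.reCLM_apply, key, Complex.sub_re, Complex.add_re, Complex.re_ofReal_mul μ,
      Complex.re_ofReal_mul, Complex.ofReal_re, Complex.sq_norm, Complex.I_mul_re,
      Complex.im_ofReal_mul]
    simp only [Complex.sub_im, Complex.add_im, Complex.im_ofReal_mul, Complex.ofReal_im]
    simp [R]
  have I1 : (∫ x in (0:ℝ)..β, (a₀ * ‖v6 x‖ ^ 2 - μ * R x)) = (G β).re - (G 0).re := by
    have hsub : Icc 0 β ⊆ Icc 0 L := Icc_subset_Icc_right hβL.le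
    apply intervalIntegral.integral_eq_sub_of_hasDerivAt_of_le hβ.le (cGr.mono hsub)
    · intro x hx
      have := dG x (Or.inl hx)
      rwa [if_pos hx.2] at this
    · apply ContinuousOn.intervalIntegrable
      rw [uIcc_of_le hβ.le]
      exact (continuousOn_const.mul ((c6.mono hsub).norm.pow 2)).sub
        (continuousOn_const.mul (cR.mono hsub))
  have iR : IntervalIntegrable R volume 0 L := by
    apply ContinuousOn.intervalIntegrable; rwa [uIcc_of_le hL.le]
  have iR1 : IntervalIntegrable R volume 0 β :=
    iR.mono_set (by rw [uIcc_of_le hL.le, uIcc_of_le hβ.le]; exact Icc_subset_Icc_right hβL.le)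
  have iR2 : IntervalIntegrable R volume β L :=
    iR.mono_set (by rw [uIcc_of_le hL.le, uIcc_of_le hβL.le]; exact Icc_subset_Icc_left hβ.le)
  have I2 : (∫ x in β..L, (- (μ * R x))) = (G L).re - (G β).re := by
    have hsub : Icc β L ⊆ Icc 0 L := Icc_subset_Icc_left hβ.le
    apply intervalIntegral.integral_eq_sub_of_hasDerivAt_of_le hβL.le (cGr.mono hsub)
    · intro x hx
      have := dG x (Or.inr hx)
      rw [if_neg (not_lt.2 hx.1.le)] at this
      simpa using this
    · exact (iR2.const_mul μ).neg
  have G0 : G 0 = 0 := by simp [G, z20, z40, z60]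
  have GLz : G L = 0 := by simp [G, z2L, z4L, z6L]
  have i6 : IntervalIntegrable (fun x => ‖v6 x‖ ^ 2) volume 0 β :=
    sqi hβ (c6.mono (Icc_subset_Icc_right hβL.le))
  rw [intervalIntegral.integral_sub (i6.const_mul _) (iR1.const_mul _),
    intervalIntegral.integral_const_mul, intervalIntegral.integral_const_mul, G0] at I1
  rw [intervalIntegral.integral_neg, intervalIntegral.integral_const_mul, GLz] at I2
  have I3 := intervalIntegral.integral_add_adjacent_intervals iR1 iR2
  have I4 : a₀ * (∫ x in (0:ℝ)..β, ‖v6 x‖ ^ 2) = μ * ∫ x in (0:ℝ)..L, R x := by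
    rw [← I3]; simp only [Complex.zero_re] at I1 I2; linarith
  rw [I4]
  apply mul_le_mul_of_nonneg_left _ hμ.le
  have cU : IntervalIntegrable (fun x => k₁ * ‖S x‖ ^ 2 + ρ₁ * ‖v2 x‖ ^ 2 + k₂ * ‖T x‖ ^ 2
      + ρ₂ * ‖v4 x‖ ^ 2 + k₃ * ‖N x‖ ^ 2 + ρ₁ * ‖v6 x‖ ^ 2) volume 0 L :=
    ((((((sqi hL cS).const_mul _).add ((sqi hL c2).const_mul _)).add ((sqi hL cT).const_mul _)).add
      ((sqi hL c4).const_mul _)).add ((sqi hL cN).const_mul _)).add ((sqi hL c6).const_mul _)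
  have cF : IntervalIntegrable (fun x => k₁ * ‖Sf x‖ ^ 2 + ρ₁ * ‖f2 x‖ ^ 2 + k₂ * ‖Tf x‖ ^ 2
      + ρ₂ * ‖f4 x‖ ^ 2 + k₃ * ‖Nf x‖ ^ 2 + ρ₁ * ‖f6 x‖ ^ 2) volume 0 L :=
    ((((((sqi hL cSf).const_mul _).add ((sqi hL cf2).const_mul _)).add
      ((sqi hL cTf).const_mul _)).add
      ((sqi hL cf4).const_mul _)).add ((sqi hL cNf).const_mul _)).add ((sqi hL cf6).const_mul _)
  rw [← intervalIntegral.integral_const_mul, ← intervalIntegral.integral_const_mul,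
    ← intervalIntegral.integral_add (cU.const_mul _) (cF.const_mul _)]
  apply intervalIntegral.integral_mono_on hL.le iR ((cU.const_mul _).add (cF.const_mul _))
  intro x _
  have am : ∀ (k : ℝ) (_ : 0 < k) (a b : ℂ), (k * (a * (starRingEnd ℂ) b)).re ≤
      t * (k * ‖a‖ ^ 2) + t⁻¹ * (k * ‖b‖ ^ 2) := by
    intro k hk a b
    rw [Complex.re_ofReal_mul]
    have h1 : (a * (starRingEnd ℂ) b).re ≤ ‖a‖ * ‖b‖ := by
      refine (Complex.re_le_norm _).trans ?_
      simp
    have h3 : t * ‖a‖ ^ 2 + t⁻¹ * ‖b‖ ^ 2 - 2 * (‖a‖ * ‖b‖) = t⁻¹ * (t * ‖a‖ - ‖b‖) ^ 2 := by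
      field_simp; ring
    have h4 : 0 ≤ t⁻¹ * (t * ‖a‖ - ‖b‖) ^ 2 := by positivity
    have h5 : 0 ≤ ‖a‖ * ‖b‖ := by positivity
    calc k * (a * (starRingEnd ℂ) b).re ≤ k * (t * ‖a‖ ^ 2 + t⁻¹ * ‖b‖ ^ 2) :=
          mul_le_mul_of_nonneg_left (by linarith) hk.le
      _ = _ := by ring
  have am' : ∀ (k : ℝ) (_ : 0 < k) (a b : ℂ), (k * (a * (starRingEnd ℂ) b)).re ≤
      t * (k * ‖b‖ ^ 2) + t⁻¹ * (k * ‖a‖ ^ 2) := by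
    intro k hk a b
    have h := am k hk b a
    have h2 : (k * (a * (starRingEnd ℂ) b)).re = (k * (b * (starRingEnd ℂ) a)).re := by
      rw [Complex.re_ofReal_mul, Complex.re_ofReal_mul, Complex.mul_re, Complex.mul_re,
        Complex.conj_re, Complex.conj_re, Complex.conj_im, Complex.conj_im]
      ring
    rw [h2]; exact h
  have a1 := am k₁ hk1 (S x) (Sf x)
  have a2 := am' ρ₁ hrho1 (f2 x) (v2 x)
  have a3 := am k₂ hk2 (T x) (Tf x)
  have a4 := am' ρ₂ hrho2 (f4 x) (v4 x)
  have a5 := am k₃ hk3 (N x) (Nf x)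
  have a6 := am' ρ₁ hrho1 (f6 x) (v6 x)
  simp only [R, Complex.add_re]
  linarith

lemma eqIcc {β : ℝ} (hβ : 0 < β) {f g : ℝ → ℂ} (hf : ContinuousOn f (Icc 0 β))
    (hg : ContinuousOn g (Icc 0 β)) (h : ∀ x ∈ Ioo 0 β, f x = g x) : ∀ x ∈ Icc 0 β, f x = g x := by
  have := Set.EqOn.of_subset_closure (s := Ioo 0 β) (t := Icc 0 β) h hf hg Ioo_subset_Icc_self
    (by rw [closure_Ioo hβ.ne])
  exact this

lemma BB_of_le {L β c K : ℝ} (hβ : 0 < β) (hβL : β < L) (hc : 0 < c) {g : ℕ → ℝ → ℂ}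
    {e : ℕ → ℝ → ℝ} (cg : ∀ n, ContinuousOn (g n) (Icc 0 L))
    (ie : ∀ n, IntervalIntegrable (e n) volume 0 L)
    (le : ∀ n x, c * ‖g n x‖ ^ 2 ≤ e n x)
    (hK : ∀ᶠ n in atTop, (∫ x in (0:ℝ)..L, e n x) ≤ K) : BB β g := by
  have hL : 0 < L := hβ.trans hβL
  refine ⟨fun n => (cg n).mono (Icc_subset_Icc_right hβL.le), c⁻¹ * K, ?_⟩
  filter_upwards [hK] with n hn
  rw [le_inv_mul_iff₀ hc]
  refine le_trans ?_ hn
  calc c * (∫ x in (0:ℝ)..β, ‖g n x‖ ^ 2) ≤ c * (∫ x in (0:ℝ)..L, ‖g n x‖ ^ 2) := by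
        apply mul_le_mul_of_nonneg_left _ hc.le
        apply intervalIntegral.integral_mono_interval le_rfl hβ.le hβL.le
        · exact Eventually.of_forall fun y => by positivity
        · exact sqi hL (cg n)
    _ = ∫ x in (0:ℝ)..L, c * ‖g n x‖ ^ 2 := by rw [intervalIntegral.integral_const_mul]
    _ ≤ ∫ x in (0:ℝ)..L, e n x :=
        intervalIntegral.integral_mono_on hL.le ((sqi hL (cg n)).const_mul _) (ie n)
          (fun x _ => le n x)

/-- components of a weighted energy are bounded -/
lemma BB_comps {L β c1 c2 c3 c4 c5 c6 K : ℝ} (hβ : 0 < β) (hβL : β < L) (h1 : 0 < c1)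
    (h2 : 0 < c2) (h3 : 0 < c3) (h4 : 0 < c4) (h5 : 0 < c5) (h6 : 0 < c6)
    {g1 g2 g3 g4 g5 g6 : ℕ → ℝ → ℂ}
    (q1 : ∀ n, ContinuousOn (g1 n) (Icc 0 L)) (q2 : ∀ n, ContinuousOn (g2 n) (Icc 0 L))
    (q3 : ∀ n, ContinuousOn (g3 n) (Icc 0 L)) (q4 : ∀ n, ContinuousOn (g4 n) (Icc 0 L))
    (q5 : ∀ n, ContinuousOn (g5 n) (Icc 0 L)) (q6 : ∀ n, ContinuousOn (g6 n) (Icc 0 L))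
    (hK : ∀ᶠ n in atTop, (∫ x in (0:ℝ)..L, (c1 * ‖g1 n x‖ ^ 2 + c2 * ‖g2 n x‖ ^ 2
      + c3 * ‖g3 n x‖ ^ 2 + c4 * ‖g4 n x‖ ^ 2 + c5 * ‖g5 n x‖ ^ 2 + c6 * ‖g6 n x‖ ^ 2)) ≤ K) :
    BB β g1 ∧ BB β g2 ∧ BB β g3 ∧ BB β g4 ∧ BB β g5 ∧ BB β g6 := by
  have hL : 0 < L := hβ.trans hβL
  have ie : ∀ n, IntervalIntegrable (fun x => c1 * ‖g1 n x‖ ^ 2 + c2 * ‖g2 n x‖ ^ 2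
      + c3 * ‖g3 n x‖ ^ 2 + c4 * ‖g4 n x‖ ^ 2 + c5 * ‖g5 n x‖ ^ 2 + c6 * ‖g6 n x‖ ^ 2)
      volume 0 L := fun n =>
    ((((((sqi hL (q1 n)).const_mul _).add ((sqi hL (q2 n)).const_mul _)).add
      ((sqi hL (q3 n)).const_mul _)).add ((sqi hL (q4 n)).const_mul _)).add
      ((sqi hL (q5 n)).const_mul _)).add ((sqi hL (q6 n)).const_mul _)
  have p1 : ∀ n x, 0 ≤ c1 * ‖g1 n x‖ ^ 2 := fun n x => by positivity
  have p2 : ∀ n x, 0 ≤ c2 * ‖g2 n x‖ ^ 2 := fun n x => by positivity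
  have p3 : ∀ n x, 0 ≤ c3 * ‖g3 n x‖ ^ 2 := fun n x => by positivity
  have p4 : ∀ n x, 0 ≤ c4 * ‖g4 n x‖ ^ 2 := fun n x => by positivity
  have p5 : ∀ n x, 0 ≤ c5 * ‖g5 n x‖ ^ 2 := fun n x => by positivity
  have p6 : ∀ n x, 0 ≤ c6 * ‖g6 n x‖ ^ 2 := fun n x => by positivity
  refine ⟨BB_of_le hβ hβL h1 q1 ie ?_ hK, BB_of_le hβ hβL h2 q2 ie ?_ hK,
    BB_of_le hβ hβL h3 q3 ie ?_ hK, BB_of_le hβ hβL h4 q4 ie ?_ hK,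
    BB_of_le hβ hβL h5 q5 ie ?_ hK, BB_of_le hβ hβL h6 q6 ie ?_ hK⟩ <;>
  · intro n x
    linarith [p1 n x, p2 n x, p3 n x, p4 n x, p5 n x, p6 n x]

lemma evD {a b : ℝ} (f : ℝ → ℂ) : ∀ x ∈ Ioo a b, derivWithin f (Icc a b) x = deriv f x :=
  fun _ hx => derivWithin_of_mem_nhds (Icc_mem_nhds hx.1 hx.2)

lemma hasD2 {a b : ℝ} (hab : a < b) {f : ℝ → ℂ} (h : ContDiffOn ℝ 2 f (Icc a b)) :
    ∀ x ∈ Ioo a b, HasDerivAt (deriv f) (derivWithin (derivWithin f (Icc a b)) (Icc a b) x) x := by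
  intro x hx
  have h1 := (c1data hab (c2data hab h)).2 x hx
  refine h1.congr_of_eventuallyEq ?_
  filter_upwards [Ioo_mem_nhds hx.1 hx.2] with y hy using (evD f y hy).symm

/-- the cut-off weight and its derivatives -/
lemma weights {β : ℝ} : ∃ φ1 φ2 φ3 : ℝ → ℂ,
    DD β (fun _ x => (((x * (β - x)) ^ 4 : ℝ) : ℂ)) (fun _ => φ1) ∧
    DD β (fun _ => φ1) (fun _ => φ2) ∧ DD β (fun _ => φ2) (fun _ => φ3) ∧
    φ1 0 = 0 ∧ φ1 β = 0 ∧ φ2 0 = 0 ∧ φ2 β = 0 := by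
  have mk : ∀ a b : ℝ → ℝ, Continuous a → Continuous b → (∀ x, HasDerivAt a (b x) x) →
      DD β (fun _ x => ((a x : ℝ) : ℂ)) (fun _ x => ((b x : ℝ) : ℂ)) := by
    intro a b ha hb h
    exact ⟨fun _ => (Complex.continuous_ofReal.comp ha).continuousOn,
      fun _ => (Complex.continuous_ofReal.comp hb).continuousOn, fun _ x _ => (h x).ofReal_comp⟩
  have hP : ∀ x, HasDerivAt (fun x : ℝ => x * (β - x)) (β - 2 * x) x := by
    intro x
    refine ((hasDerivAt_id x).mul ((hasDerivAt_id x).const_sub β)).congr_deriv ?_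
    simp; ring
  have hQ : ∀ x, HasDerivAt (fun x : ℝ => β - 2 * x) (-2) x := by
    intro x
    refine (((hasDerivAt_id x).const_mul 2).const_sub β).congr_deriv ?_
    simp
  refine ⟨fun x => ((4 * (x * (β - x)) ^ 3 * (β - 2 * x) : ℝ) : ℂ),
    fun x => ((12 * (x * (β - x)) ^ 2 * (β - 2 * x) ^ 2 - 8 * (x * (β - x)) ^ 3 : ℝ) : ℂ),
    fun x => ((24 * (x * (β - x)) * (β - 2 * x) ^ 3 - 72 * (x * (β - x)) ^ 2 * (β - 2 * x) : ℝ) : ℂ),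
    mk _ _ (by fun_prop) (by fun_prop) ?_, mk _ _ (by fun_prop) (by fun_prop) ?_,
    mk _ _ (by fun_prop) (by fun_prop) ?_, by simp, by simp, by simp, by simp⟩
  · intro x
    refine ((hP x).pow 4).congr_deriv ?_
    norm_num
  · intro x
    refine ((((hP x).pow 3).const_mul 4).mul (hQ x)).congr_deriv ?_
    simp; ring
  · intro x
    refine (((((hP x).pow 2).const_mul 12).mul ((hQ x).pow 2)).sub
      (((hP x).pow 3).const_mul 8)).congr_deriv ?_
    simp; ring

/-- final extraction of a local bound from the weighted one -/
lemma extract {β : ℝ} (hβ : 0 < β) {c : ℕ → ℝ} (hc : ∀ n, 0 ≤ c n) {p : ℕ → ℝ → ℂ}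
    (cp : ∀ n, ContinuousOn (p n) (Icc 0 β))
    (h : OO β (fun n x => (c n : ℂ) * (p n x * (((x * (β - x)) ^ 4 : ℝ) : ℂ)
      * (starRingEnd ℂ) (p n x)))) {s : ℝ} (hs : 0 < s) (hsβ : s < β / 2) :
    Tendsto (fun n => c n * ∫ x in s..(β - s), ‖p n x‖ ^ 2) atTop (nhds 0) := by
  have e1 : ∀ n, (∫ x in (0:ℝ)..β, (c n : ℂ) * (p n x * (((x * (β - x)) ^ 4 : ℝ) : ℂ)
      * (starRingEnd ℂ) (p n x))) =
      ((c n * ∫ x in (0:ℝ)..β, (x * (β - x)) ^ 4 * ‖p n x‖ ^ 2 : ℝ) : ℂ) := by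
    intro n
    rw [← intervalIntegral.integral_const_mul, ← intervalIntegral.integral_ofReal]
    congr 1
    ext x
    have := Complex.mul_conj' (p n x)
    push_cast
    linear_combination (c n : ℂ) * ((x : ℂ) * (β - x)) ^ 4 * this
  have h2 : Tendsto (fun n => c n * ∫ x in (0:ℝ)..β, (x * (β - x)) ^ 4 * ‖p n x‖ ^ 2) atTop
      (nhds 0) := by
    have := (Complex.continuous_re.tendsto 0).comp h.2
    refine this.congr fun n => ?_
    simp only [Function.comp, e1, Complex.ofReal_re]
  have hm : 0 < (s * s) ^ 4 := by positivity
  have h3 : Tendsto (fun n => ((s * s) ^ 4)⁻¹ *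
      (c n * ∫ x in (0:ℝ)..β, (x * (β - x)) ^ 4 * ‖p n x‖ ^ 2)) atTop (nhds 0) := by
    simpa using h2.const_mul (((s * s) ^ 4)⁻¹)
  have hss : s ≤ β - s := by linarith
  refine squeeze_zero (fun n => mul_nonneg (hc n)
    (intervalIntegral.integral_nonneg hss fun _ _ => by positivity)) (fun n => ?_) h3
  rw [le_inv_mul_iff₀ hm]
  have ii : IntervalIntegrable (fun x => (x * (β - x)) ^ 4 * ‖p n x‖ ^ 2) volume 0 β := by
    apply ContinuousOn.intervalIntegrable
    rw [uIcc_of_le hβ.le]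
    exact ContinuousOn.mul (by fun_prop) ((cp n).norm.pow 2)
  have hsub : uIcc s (β - s) ⊆ uIcc 0 β := by
    rw [uIcc_of_le hss, uIcc_of_le hβ.le]; exact Icc_subset_Icc hs.le (by linarith)
  have hle : (s * s) ^ 4 * (∫ x in s..(β - s), ‖p n x‖ ^ 2) ≤
      ∫ x in (0:ℝ)..β, (x * (β - x)) ^ 4 * ‖p n x‖ ^ 2 := by
    calc (s * s) ^ 4 * (∫ x in s..(β - s), ‖p n x‖ ^ 2)
        = ∫ x in s..(β - s), (s * s) ^ 4 * ‖p n x‖ ^ 2 := by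
          rw [intervalIntegral.integral_const_mul]
      _ ≤ ∫ x in s..(β - s), (x * (β - x)) ^ 4 * ‖p n x‖ ^ 2 := by
          apply intervalIntegral.integral_mono_on hss
            (((sqi hβ (cp n)).mono_set hsub).const_mul _) (ii.mono_set hsub)
          intro x hx
          apply mul_le_mul_of_nonneg_right _ (by positivity)
          apply pow_le_pow_left₀ (by positivity)
          exact mul_le_mul hx.1 (by linarith [hx.2]) hs.le (by linarith [hx.1])
      _ ≤ _ := by
          apply intervalIntegral.integral_mono_interval hs.le hss (by linarith) _ ii
          exact Eventually.of_forall fun y => by positivity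
  calc (s * s) ^ 4 * (c n * ∫ x in s..(β - s), ‖p n x‖ ^ 2)
      = c n * ((s * s) ^ 4 * ∫ x in s..(β - s), ‖p n x‖ ^ 2) := by ring
    _ ≤ _ := mul_le_mul_of_nonneg_left hle (hc n)

lemma diff_eq {L : ℝ} (hL : 0 < L) {U : Set ℝ} (hU : IsOpen U) (hUL : U ⊆ Ioo 0 L)
    {a b f : ℝ → ℂ} {c m : ℂ} (ha : ContDiffOn ℝ 1 a (Icc 0 L)) (hb : ContDiffOn ℝ 1 b (Icc 0 L))
    (hf : ContDiffOn ℝ 1 f (Icc 0 L)) (h : ∀ x ∈ U, c * a x - b x = m * f x) :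
    ∀ x ∈ U, c * derivWithin a (Icc 0 L) x - derivWithin b (Icc 0 L) x
      = m * derivWithin f (Icc 0 L) x := by
  intro x hx
  have h1 := (((c1data hL ha).2 x (hUL hx)).const_mul c).sub ((c1data hL hb).2 x (hUL hx))
  have h2 := ((c1data hL hf).2 x (hUL hx)).const_mul m
  refine h1.unique (h2.congr_of_eventuallyEq ?_)
  filter_upwards [hU.mem_nhds hx] with y hy using h y hy

lemma union_sub {β L : ℝ} (hβ : 0 < β) (hβL : β < L) : Ioo 0 β ∪ Ioo β L ⊆ Ioo 0 L :=
  union_subset (Ioo_subset_Ioo_right hβL.le) (Ioo_subset_Ioo_left hβ.le)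

lemma step1 {ρ₁ ρ₂ k₁ k₂ k₃ l L β a₀ : ℝ}
    (hrho1 : 0 < ρ₁) (hrho2 : 0 < ρ₂) (hk1 : 0 < k₁) (hk2 : 0 < k₂) (hk3 : 0 < k₃)
    (hL : 0 < L) (hβ : 0 < β) (hβL : β < L)
    (S : BresseSetting ρ₁ ρ₂ k₁ k₂ k₃ l L β a₀ 4)
    (μ : ℕ → ℝ) (hμ : ∀ n, 0 < μ n) (hz : ∀ n, (S.lam n : ℂ) ^ (-((4 : ℕ) : ℤ)) = ((μ n : ℝ) : ℂ))
    (n : ℕ) {t : ℝ} (ht : 0 < t) :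
    a₀ * (∫ x in (0:ℝ)..β, ‖S.v6 n x‖ ^ 2) ≤ μ n * (t * 1 + t⁻¹ * (∫ x in (0 : ℝ)..L,
      (k₁ * ‖deriv (S.f1 n) x + S.f3 n x + (l : ℂ) * S.f5 n x‖ ^ 2 + ρ₁ * ‖S.f2 n x‖ ^ 2
        + k₂ * ‖deriv (S.f3 n) x‖ ^ 2 + ρ₂ * ‖S.f4 n x‖ ^ 2
        + k₃ * ‖deriv (S.f5 n) x - (l : ℂ) * S.f1 n x‖ ^ 2 + ρ₁ * ‖S.f6 n x‖ ^ 2))) := by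
  have hsub := union_sub hβ hβL
  have hU : IsOpen (Ioo 0 β ∪ Ioo β L) := isOpen_Ioo.union isOpen_Ioo
  have r1 := (S.reg_v1 n).of_le (m := 1) (by norm_num)
  have r3 := (S.reg_v3 n).of_le (m := 1) (by norm_num)
  have r5 := S.reg_v5 n
  have c1 := c1data hL r1
  have c3 := c1data hL r3
  have c5 := c1data hL r5
  have q2 := c1data hL (S.reg_v2 n)
  have q4 := c1data hL (S.reg_v4 n)
  have q6 := c1data hL (S.reg_v6 n)
  have m1 := c1data hL (S.reg_f1 n)
  have m3 := c1data hL (S.reg_f3 n)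
  have m5 := c1data hL (S.reg_f5 n)
  have d1 := diff_eq hL hU hsub r1 (S.reg_v2 n) (S.reg_f1 n) (S.eq1 n)
  have d3 := diff_eq hL hU hsub r3 (S.reg_v4 n) (S.reg_f3 n) (S.eq3 n)
  have d5 := diff_eq hL hU hsub r5 (S.reg_v6 n) (S.reg_f5 n) (S.eq5 n)
  have e1 := S.eq1 n
  have e2 := S.eq2 n
  have e3 := S.eq3 n
  have e4 := S.eq4 n
  have e5 := S.eq5 n
  have e6 := S.eq6 n
  simp only [hz] at d1 d3 d5 e1 e2 e3 e4 e5 e6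
  have hN5 : ∀ x ∈ Ioo 0 β ∪ Ioo β L, DifferentiableAt ℝ (deriv (S.v5 n)) x := by
    rintro x (hx | hx)
    · exact (hasD2 hβ (S.reg_v5_left n) x hx).differentiableAt
    · exact (hasD2 hβL (S.reg_v5_right n) x hx).differentiableAt
  have hN1 : ∀ x ∈ Ioo 0 β ∪ Ioo β L, DifferentiableAt ℝ (deriv (S.v1 n)) x := fun x hx =>
    (hasD2 hL (S.reg_v1 n) x (hsub hx)).differentiableAt
  have hN3 : ∀ x ∈ Ioo 0 β ∪ Ioo β L, DifferentiableAt ℝ (deriv (S.v3 n)) x := fun x hx =>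
    (hasD2 hL (S.reg_v3 n) x (hsub hx)).differentiableAt
  have en := energy (a₀ := a₀) (l := l) (lm := S.lam n) hrho1 hrho2 hk1 hk2 hk3 hβ hβL (hμ n)
    (S := fun x => derivWithin (S.v1 n) (Icc 0 L) x + S.v3 n x + (l : ℂ) * S.v5 n x)
    (T := derivWithin (S.v3 n) (Icc 0 L))
    (N := fun x => derivWithin (S.v5 n) (Icc 0 L) x - (l : ℂ) * S.v1 n x)
    (S1 := deriv (fun y => deriv (S.v1 n) y + S.v3 n y + (l : ℂ) * S.v5 n y))
    (T1 := deriv (deriv (S.v3 n)))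
    (N1 := deriv (fun y => deriv (S.v5 n) y - (l : ℂ) * S.v1 n y))
    (v2 := S.v2 n) (v4 := S.v4 n) (v6 := S.v6 n)
    (d2 := derivWithin (S.v2 n) (Icc 0 L)) (d4 := derivWithin (S.v4 n) (Icc 0 L))
    (d6 := derivWithin (S.v6 n) (Icc 0 L))
    (Sf := fun x => derivWithin (S.f1 n) (Icc 0 L) x + S.f3 n x + (l : ℂ) * S.f5 n x)
    (Tf := derivWithin (S.f3 n) (Icc 0 L))
    (Nf := fun x => derivWithin (S.f5 n) (Icc 0 L) x - (l : ℂ) * S.f1 n x)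
    (f2 := S.f2 n) (f4 := S.f4 n) (f6 := S.f6 n)
    ((c1.1.add r3.continuousOn).add (r5.continuousOn.const_smul (l : ℂ))) c3.1
    (c5.1.sub (r1.continuousOn.const_smul (l : ℂ)))
    (S.reg_v2 n).continuousOn (S.reg_v4 n).continuousOn (S.reg_v6 n).continuousOn
    ((m1.1.add (S.reg_f3 n).continuousOn).add ((S.reg_f5 n).continuousOn.const_smul (l : ℂ))) m3.1
    (m5.1.sub ((S.reg_f1 n).continuousOn.const_smul (l : ℂ)))
    (S.reg_f2 n) (S.reg_f4 n) (S.reg_f6 n)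
    (by
      intro x hx
      have h0 : DifferentiableAt ℝ (fun y => deriv (S.v1 n) y + S.v3 n y + (l : ℂ) * S.v5 n y) x :=
        ((hN1 x hx).add (c3.2 x (hsub hx)).differentiableAt).add
          ((c5.2 x (hsub hx)).differentiableAt.const_mul _)
      refine h0.hasDerivAt.congr_of_eventuallyEq ?_
      filter_upwards [hU.mem_nhds hx] with y hy
      rw [evD _ y (hsub hy)])
    (by
      intro x hx
      refine (hN3 x hx).hasDerivAt.congr_of_eventuallyEq ?_
      filter_upwards [hU.mem_nhds hx] with y hy
      rw [evD _ y (hsub hy)])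
    (by
      intro x hx
      have h0 : DifferentiableAt ℝ (fun y => deriv (S.v5 n) y - (l : ℂ) * S.v1 n y) x :=
        (hN5 x hx).sub ((c1.2 x (hsub hx)).differentiableAt.const_mul _)
      refine h0.hasDerivAt.congr_of_eventuallyEq ?_
      filter_upwards [hU.mem_nhds hx] with y hy
      rw [evD _ y (hsub hy)])
    (fun x hx => q2.2 x (hsub hx)) (fun x hx => q4.2 x (hsub hx)) (fun x hx => q6.2 x (hsub hx))
    (by
      intro x hx
      rw [evD _ x (hsub hx)]; exact e2 x hx)
    (by
      intro x hx
      rw [evD _ x (hsub hx)]; exact e4 x hx)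
    (by
      intro x hx
      rw [evD _ x (hsub hx)]; exact e6 x hx)
    (by
      intro x hx
      linear_combination (-1 : ℂ) * d1 x hx - e3 x hx - l * e5 x hx)
    (by
      intro x hx
      linear_combination (-1 : ℂ) * d3 x hx)
    (by
      intro x hx
      linear_combination (-1 : ℂ) * d5 x hx + l * e1 x hx)
    (S.bc_zero n).2.1 (S.bc_zero n).2.2.2.1 (S.bc_zero n).2.2.2.2.2.1
    (S.bc_L n).2.1 (S.bc_L n).2.2.2.1 (S.bc_L n).2.2.2.2.2.1 ht
  have nu := S.normU n
  have i1 : (∫ x in (0 : ℝ)..L,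
      (k₁ * ‖derivWithin (S.v1 n) (Icc 0 L) x + S.v3 n x + (l : ℂ) * S.v5 n x‖ ^ 2
        + ρ₁ * ‖S.v2 n x‖ ^ 2
        + k₂ * ‖derivWithin (S.v3 n) (Icc 0 L) x‖ ^ 2 + ρ₂ * ‖S.v4 n x‖ ^ 2
        + k₃ * ‖derivWithin (S.v5 n) (Icc 0 L) x - (l : ℂ) * S.v1 n x‖ ^ 2
        + ρ₁ * ‖S.v6 n x‖ ^ 2)) = 1 := by
    rw [← nu]
    exact int_congr_Ioo hL.le fun x hx => by simp only [evD _ x hx]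
  rw [i1] at en
  refine en.trans_eq ?_
  congr 3
  exact int_congr_Ioo hL.le fun x hx => by simp only [evD _ x hx]

lemma step2 {ρ₁ ρ₂ k₁ k₂ k₃ l L β a₀ : ℝ}
    (hrho1 : 0 < ρ₁) (hrho2 : 0 < ρ₂) (hk1 : 0 < k₁) (hk2 : 0 < k₂) (hk3 : 0 < k₃)
    (hL : 0 < L) (ha0 : 0 < a₀) (hβ : 0 < β) (hβL : β < L)
    (S : BresseSetting ρ₁ ρ₂ k₁ k₂ k₃ l L β a₀ 4) :
    ZZ β (fun n x => (S.lam n : ℂ) ^ 2 * S.v6 n x) := by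
  have c6 : ∀ n, ContinuousOn (S.v6 n) (Icc 0 β) := fun n =>
    (S.reg_v6 n).continuousOn.mono (Icc_subset_Icc_right hβL.le)
  refine ⟨fun n => continuousOn_const.mul (c6 n), ?_⟩
  have e0 : ∀ n, (∫ x in (0:ℝ)..β, ‖(S.lam n : ℂ) ^ 2 * S.v6 n x‖ ^ 2)
      = S.lam n ^ 4 * ∫ x in (0:ℝ)..β, ‖S.v6 n x‖ ^ 2 := by
    intro n
    rw [← intervalIntegral.integral_const_mul]
    congr 1
    ext x
    rw [norm_mul, norm_pow, Complex.norm_real, Real.norm_eq_abs, mul_pow, sq_abs]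
    ring
  have hp : ∀ n, 0 < S.lam n ^ 4 := fun n => by
    have := S.lam_ne n
    positivity
  rw [tendsto_order]
  refine ⟨fun b hb => Eventually.of_forall fun n => hb.trans_le (sq_int_nonneg hβ _), ?_⟩
  intro b hb
  have ht : 0 < a₀ * b / 2 := by positivity
  have hF := S.normF
  have hF2 := (tendsto_order.1 (hF.const_mul (a₀ * b / 2)⁻¹)).2 (a₀ * b / 2) (by simpa using ht)
  filter_upwards [hF2] with n hn
  have h1 := step1 hrho1 hrho2 hk1 hk2 hk3 hL hβ hβL S (fun n => (S.lam n ^ 4)⁻¹)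
    (fun n => inv_pos.2 (hp n)) (fun n => by
      rw [zpow_neg, zpow_natCast]; push_cast; rfl) n ht
  rw [e0]
  rw [le_inv_mul_iff₀ (hp n)] at h1
  have h2 : a₀ * (S.lam n ^ 4 * ∫ x in (0:ℝ)..β, ‖S.v6 n x‖ ^ 2) < a₀ * b := by
    calc _ = S.lam n ^ 4 * (a₀ * ∫ x in (0:ℝ)..β, ‖S.v6 n x‖ ^ 2) := by ring
      _ ≤ _ := h1
      _ < a₀ * b := by linarith
  exact lt_of_mul_lt_mul_left h2 ha0.le

lemma step3 {ρ₁ ρ₂ k₁ k₂ k₃ l L β a₀ : ℝ}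
    (hrho1 : 0 < ρ₁) (hrho2 : 0 < ρ₂) (hk1 : 0 < k₁) (hk2 : 0 < k₂) (hk3 : 0 < k₃)
    (hl : 0 < l) (hL : 0 < L) (ha0 : 0 < a₀) (hβ : 0 < β) (hβL : β < L)
    (S : BresseSetting ρ₁ ρ₂ k₁ k₂ k₃ l L β a₀ 4) :
    OO β (fun n x => (S.lam n : ℂ) ^ 2 * (S.v3 n x * (((x * (β - x)) ^ 4 : ℝ) : ℂ)
      * (starRingEnd ℂ) (S.v3 n x))) ∧
    OO β (fun n x => derivWithin (S.v3 n) (Icc 0 L) x * (((x * (β - x)) ^ 4 : ℝ) : ℂ)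
      * (starRingEnd ℂ) (derivWithin (S.v3 n) (Icc 0 L) x)) := by
  have zv6 := step2 hrho1 hrho2 hk1 hk2 hk3 hL ha0 hβ hβL S
  have hΛ : ∀ n, (S.lam n : ℂ) ≠ 0 := fun n => by exact_mod_cast S.lam_ne n
  have hT : Tendsto (fun n => ((S.lam n : ℂ))⁻¹) atTop (nhds 0) := by
    rw [tendsto_zero_iff_norm_tendsto_zero]
    refine (tendsto_inv_atTop_zero.comp S.lam_tendsto).congr fun n => ?_
    simp
  have hTk : ∀ k : ℕ, k ≠ 0 → Tendsto (fun n => ((S.lam n : ℂ))⁻¹ ^ k) atTop (nhds 0) := by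
    intro k hk
    have := hT.pow k
    rwa [zero_pow hk] at this
  have hz : ∀ n, (S.lam n : ℂ) ^ (-((4 : ℕ) : ℤ)) = ((S.lam n : ℂ))⁻¹ ^ 4 := fun n => by
    rw [zpow_neg, zpow_natCast, inv_pow]
  have hsub : Icc 0 β ⊆ Icc 0 L := Icc_subset_Icc_right hβL.le
  have hsubo : Ioo 0 β ⊆ Ioo 0 L := Ioo_subset_Ioo_right hβL.le
  -- derivative data
  have mkDD : ∀ f : ℕ → ℝ → ℂ, (∀ n, ContDiffOn ℝ 1 (f n) (Icc 0 L)) →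
      DD β f (fun n => derivWithin (f n) (Icc 0 L)) := fun f hf =>
    ⟨fun n => (hf n).continuousOn.mono hsub, fun n => (c1data hL (hf n)).1.mono hsub,
      fun n x hx => (c1data hL (hf n)).2 x (hsubo hx)⟩
  have r1 : ∀ n, ContDiffOn ℝ 1 (S.v1 n) (Icc 0 L) := fun n =>
    (S.reg_v1 n).of_le (by norm_num)
  have r3 : ∀ n, ContDiffOn ℝ 1 (S.v3 n) (Icc 0 L) := fun n =>
    (S.reg_v3 n).of_le (by norm_num)
  have du := mkDD S.v1 r1
  have dp := mkDD S.v3 r3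
  have dw := mkDD S.v5 S.reg_v5
  have du1 := mkDD _ (fun n => c2data hL (S.reg_v1 n))
  have dp1 := mkDD _ (fun n => c2data hL (S.reg_v3 n))
  have ew : ∀ n, ∀ x ∈ Icc 0 β, derivWithin (S.v5 n) (Icc 0 L) x
      = derivWithin (S.v5 n) (Icc 0 β) x := fun n x hx =>
    (derivWithin_subset hsub (uniqueDiffOn_Icc hβ x hx)
      (((S.reg_v5 n).differentiableOn one_ne_zero) x (hsub hx))).symm
  have cw1 : ∀ n, ContDiffOn ℝ 1 (derivWithin (S.v5 n) (Icc 0 L)) (Icc 0 β) := fun n =>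
    (c2data hβ (S.reg_v5_left n)).congr (ew n)
  have dw1 : DD β (fun n => derivWithin (S.v5 n) (Icc 0 L))
      (fun n => derivWithin (derivWithin (S.v5 n) (Icc 0 L)) (Icc 0 β)) :=
    ⟨fun n => (cw1 n).continuousOn, fun n => (c1data hβ (cw1 n)).1,
      fun n => (c1data hβ (cw1 n)).2⟩
  have df1 := mkDD S.f1 S.reg_f1
  have df3 := mkDD S.f3 S.reg_f3
  have df5 := mkDD S.f5 S.reg_f5
  have cv2 : ∀ n, ContinuousOn (S.v2 n) (Icc 0 β) := fun n => (S.reg_v2 n).continuousOn.mono hsub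
  have cv4 : ∀ n, ContinuousOn (S.v4 n) (Icc 0 β) := fun n => (S.reg_v4 n).continuousOn.mono hsub
  have cv6 : ∀ n, ContinuousOn (S.v6 n) (Icc 0 β) := fun n => (S.reg_v6 n).continuousOn.mono hsub
  have cf2 : ∀ n, ContinuousOn (S.f2 n) (Icc 0 β) := fun n => (S.reg_f2 n).mono hsub
  have cf4 : ∀ n, ContinuousOn (S.f4 n) (Icc 0 β) := fun n => (S.reg_f4 n).mono hsub
  have cf6 : ∀ n, ContinuousOn (S.f6 n) (Icc 0 β) := fun n => (S.reg_f6 n).mono hsub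
  -- energy bounds
  obtain ⟨bS, bv2, bT, bv4, bN, -⟩ := BB_comps (K := 1) hβ hβL hk1 hrho1 hk2 hrho2 hk3 hrho1
    (g1 := fun n x => derivWithin (S.v1 n) (Icc 0 L) x + S.v3 n x + (l : ℂ) * S.v5 n x)
    (g2 := S.v2) (g3 := fun n => derivWithin (S.v3 n) (Icc 0 L)) (g4 := S.v4)
    (g5 := fun n x => derivWithin (S.v5 n) (Icc 0 L) x - (l : ℂ) * S.v1 n x) (g6 := S.v6)
    (fun n => ((c1data hL (r1 n)).1.add (r3 n).continuousOn).add
      ((S.reg_v5 n).continuousOn.const_smul (l : ℂ)))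
    (fun n => (S.reg_v2 n).continuousOn) (fun n => (c1data hL (r3 n)).1)
    (fun n => (S.reg_v4 n).continuousOn)
    (fun n => (c1data hL (S.reg_v5 n)).1.sub ((r1 n).continuousOn.const_smul (l : ℂ)))
    (fun n => (S.reg_v6 n).continuousOn)
    (Eventually.of_forall fun n => by
      rw [← S.normU n]
      exact (int_congr_Ioo hL.le fun x hx => by simp only [evD _ x hx]).le)
  obtain ⟨bSf, bf2, bTf, bf4, bNf, bf6⟩ := BB_comps (K := 1) hβ hβL hk1 hrho1 hk2 hrho2 hk3 hrho1
    (g1 := fun n x => derivWithin (S.f1 n) (Icc 0 L) x + S.f3 n x + (l : ℂ) * S.f5 n x)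
    (g2 := S.f2) (g3 := fun n => derivWithin (S.f3 n) (Icc 0 L)) (g4 := S.f4)
    (g5 := fun n x => derivWithin (S.f5 n) (Icc 0 L) x - (l : ℂ) * S.f1 n x) (g6 := S.f6)
    (fun n => ((c1data hL (S.reg_f1 n)).1.add (S.reg_f3 n).continuousOn).add
      ((S.reg_f5 n).continuousOn.const_smul (l : ℂ)))
    S.reg_f2 (fun n => (c1data hL (S.reg_f3 n)).1) S.reg_f4
    (fun n => (c1data hL (S.reg_f5 n)).1.sub ((S.reg_f1 n).continuousOn.const_smul (l : ℂ)))
    S.reg_f6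
    (by
      filter_upwards [(tendsto_order.1 S.normF).2 1 one_pos] with n hn
      refine le_trans (le_of_eq ?_) hn.le
      exact int_congr_Ioo hL.le fun x hx => by simp only [evD _ x hx])
  have bf3 : BB β S.f3 := BB.primitive hβ df3 (fun n => (S.bc_zero n).2.2.2.2.2.2.2.1) bTf
  have bf15 := rot_bound (l := l) hβ df1 df5 (fun n => (S.bc_zero n).2.2.2.2.2.2.1)
    (fun n => (S.bc_zero n).2.2.2.2.2.2.2.2)
    (BB.congr hβ (bSf.add hβ (bf3.smul hβ (SB.const (-1)))) (fun n x _ => by ring)) bNf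
  obtain ⟨bf1, bf5⟩ := bf15
  -- first order relations
  have q1 : ∀ n, ∀ x ∈ Icc 0 β, Complex.I * (S.lam n : ℂ) * S.v1 n x - S.v2 n x
      = ((S.lam n : ℂ))⁻¹ ^ 4 * S.f1 n x := fun n =>
    eqIcc hβ ((continuousOn_const.mul (du.c0 n)).sub (cv2 n)) (continuousOn_const.mul (df1.c0 n))
      (fun x hx => by rw [← hz]; exact S.eq1 n x (Or.inl hx))
  have q3 : ∀ n, ∀ x ∈ Icc 0 β, Complex.I * (S.lam n : ℂ) * S.v3 n x - S.v4 n x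
      = ((S.lam n : ℂ))⁻¹ ^ 4 * S.f3 n x := fun n =>
    eqIcc hβ ((continuousOn_const.mul (dp.c0 n)).sub (cv4 n)) (continuousOn_const.mul (df3.c0 n))
      (fun x hx => by rw [← hz]; exact S.eq3 n x (Or.inl hx))
  have q5 : ∀ n, ∀ x ∈ Icc 0 β, Complex.I * (S.lam n : ℂ) * S.v5 n x - S.v6 n x
      = ((S.lam n : ℂ))⁻¹ ^ 4 * S.f5 n x := fun n =>
    eqIcc hβ ((continuousOn_const.mul (dw.c0 n)).sub (cv6 n)) (continuousOn_const.mul (df5.c0 n))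
      (fun x hx => by rw [← hz]; exact S.eq5 n x (Or.inl hx))
  have hI := Complex.I_sq
  have bu : BB β (fun n x => (S.lam n : ℂ) * S.v1 n x) :=
    BB.congr hβ ((bv2.add hβ (bf1.smul hβ (SB.of_tendsto (hTk 4 (by norm_num))))).smul hβ
      (SB.const (-Complex.I))) (fun n x hx => by
        linear_combination (-Complex.I) * q1 n x hx + S.lam n * S.v1 n x * hI)
  have bp : BB β (fun n x => (S.lam n : ℂ) * S.v3 n x) :=
    BB.congr hβ ((bv4.add hβ (bf3.smul hβ (SB.of_tendsto (hTk 4 (by norm_num))))).smul hβ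
      (SB.const (-Complex.I))) (fun n x hx => by
        linear_combination (-Complex.I) * q3 n x hx + S.lam n * S.v3 n x * hI)
  have ei : ∀ n, (S.lam n : ℂ) * ((S.lam n : ℂ))⁻¹ = 1 := fun n => mul_inv_cancel₀ (hΛ n)
  have e2' : ∀ n, (S.lam n : ℂ) ^ 2 * ((S.lam n : ℂ))⁻¹ ^ 4 = ((S.lam n : ℂ))⁻¹ ^ 2 := fun n => by
    have := hΛ n
    field_simp
  have e1' : ∀ n, (S.lam n : ℂ) * ((S.lam n : ℂ))⁻¹ ^ 4 = ((S.lam n : ℂ))⁻¹ ^ 3 := fun n => by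
    have := hΛ n
    field_simp
  have zw : ZZ β (fun n x => (S.lam n : ℂ) ^ 3 * S.v5 n x) :=
    ZZ.congr hβ ((zv6.add hβ (bf5.smul_zz hβ (hTk 2 (by norm_num)))).smul hβ
      (SB.const (-Complex.I))) (fun n x hx => by
        linear_combination (-Complex.I) * S.lam n ^ 2 * q5 n x hx + S.lam n ^ 3 * S.v5 n x * hI
          - Complex.I * S.f5 n x * e2' n)
  have b0u : BB β S.v1 := BB.congr hβ (bu.smul hβ (SB.of_tendsto hT))
    (fun n x _ => by linear_combination (-S.v1 n x) * ei n)
  have b0p : BB β S.v3 := BB.congr hβ (bp.smul hβ (SB.of_tendsto hT))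
    (fun n x _ => by linear_combination (-S.v3 n x) * ei n)
  have b0w : BB β S.v5 := BB.congr hβ (zw.bb.smul hβ (SB.of_tendsto (hTk 3 (by norm_num))))
    (fun n x _ => by
      have := hΛ n
      field_simp)
  have bu1 : BB β (fun n => derivWithin (S.v1 n) (Icc 0 L)) :=
    BB.congr hβ ((bS.add hβ (b0p.smul hβ (SB.const (-1)))).add hβ (b0w.smul hβ (SB.const (-l))))
      (fun n x _ => by ring)
  have bw1 : BB β (fun n => derivWithin (S.v5 n) (Icc 0 L)) :=
    BB.congr hβ (bN.add hβ (b0u.smul hβ (SB.const l))) (fun n x _ => by ring)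
  -- right-hand sides
  have zf : ∀ f : ℕ → ℝ → ℂ, BB β f → ∀ (c : ℂ) (k : ℕ), k ≠ 0 →
      ZZ β (fun n x => c * (((S.lam n : ℂ))⁻¹ ^ k * f n x)) := fun f hf c k hk =>
    (hf.smul_zz hβ (hTk k hk)).smul hβ (SB.const c)
  have zg2 := (zf _ bf2 ρ₁ 4 (by norm_num)).add hβ (zf _ bf1 (Complex.I * ρ₁) 3 (by norm_num))
  have zg4 := (zf _ bf4 ρ₂ 4 (by norm_num)).add hβ (zf _ bf3 (Complex.I * ρ₂) 3 (by norm_num))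
  have zg6' := ((zf _ bf6 ρ₁ 3 (by norm_num)).add hβ
    (zf _ bf5 (Complex.I * ρ₁) 2 (by norm_num))).add hβ (zf _ bf5 a₀ 3 (by norm_num))
  have zg6 : ZZ β (fun n x => (S.lam n : ℂ) * ((ρ₁ * (((S.lam n : ℂ))⁻¹ ^ 4 * S.f6 n x)
      + (Complex.I * ρ₁) * (((S.lam n : ℂ))⁻¹ ^ 3 * S.f5 n x))
      + a₀ * (((S.lam n : ℂ))⁻¹ ^ 4 * S.f5 n x))) := ZZ.congr hβ zg6' (fun n x _ => by
    have e0' : (S.lam n : ℂ) * ((S.lam n : ℂ))⁻¹ ^ 3 = ((S.lam n : ℂ))⁻¹ ^ 2 := by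
      have := hΛ n
      field_simp
    linear_combination ρ₁ * S.f6 n x * e1' n + Complex.I * ρ₁ * S.f5 n x * e0'
      + a₀ * S.f5 n x * e1' n)
  have cc : ∀ (c : ℂ) {f : ℝ → ℂ}, ContinuousOn f (Icc 0 β) →
      ContinuousOn (fun x => c * f x) (Icc 0 β) := fun c f hf => continuousOn_const.mul hf
  have E2 : ∀ n, ∀ x ∈ Icc 0 β, -(S.lam n : ℂ) ^ 2 * ρ₁ * S.v1 n x
      - k₁ * (derivWithin (derivWithin (S.v1 n) (Icc 0 L)) (Icc 0 L) x
        + derivWithin (S.v3 n) (Icc 0 L) x + l * derivWithin (S.v5 n) (Icc 0 L) x)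
      - l * k₃ * (derivWithin (S.v5 n) (Icc 0 L) x - l * S.v1 n x)
      = ρ₁ * (((S.lam n : ℂ))⁻¹ ^ 4 * S.f2 n x)
        + (Complex.I * ρ₁) * (((S.lam n : ℂ))⁻¹ ^ 3 * S.f1 n x) := by
    intro n
    refine eqIcc hβ
      (((cc _ (du.c0 n)).sub (cc _ (((du1.c1 n).add (dp.c1 n)).add (cc _ (dw.c1 n))))).sub
        (cc _ ((dw.c1 n).sub (cc _ (du.c0 n))))) (zg2.1 n) ?_
    intro x hx
    have h1 := q1 n x ⟨hx.1.le, hx.2.le⟩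
    have h2 := S.eq2 n x (Or.inl hx)
    have hd : HasDerivAt (fun y => deriv (S.v1 n) y + S.v3 n y + (l : ℂ) * S.v5 n y)
        (derivWithin (derivWithin (S.v1 n) (Icc 0 L)) (Icc 0 L) x
        + derivWithin (S.v3 n) (Icc 0 L) x + l * derivWithin (S.v5 n) (Icc 0 L) x) x :=
      ((hasD2 hL (S.reg_v1 n) x (hsubo hx)).add (dp.der n x hx)).add
        ((dw.der n x hx).const_mul (l : ℂ))
    rw [hd.deriv, hz, ← evD _ x (hsubo hx)] at h2
    linear_combination h2 + Complex.I * ρ₁ * S.lam n * h1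
      + Complex.I * ρ₁ * S.f1 n x * e1' n - S.lam n ^ 2 * ρ₁ * S.v1 n x * hI
  have E4 : ∀ n, ∀ x ∈ Icc 0 β, -(S.lam n : ℂ) ^ 2 * ρ₂ * S.v3 n x
      - k₂ * derivWithin (derivWithin (S.v3 n) (Icc 0 L)) (Icc 0 L) x
      + k₁ * (derivWithin (S.v1 n) (Icc 0 L) x + S.v3 n x + l * S.v5 n x)
      = ρ₂ * (((S.lam n : ℂ))⁻¹ ^ 4 * S.f4 n x)
        + (Complex.I * ρ₂) * (((S.lam n : ℂ))⁻¹ ^ 3 * S.f3 n x) := by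
    intro n
    refine eqIcc hβ
      (((cc _ (dp.c0 n)).sub (cc _ (dp1.c1 n))).add
        (cc _ (((du.c1 n).add (dp.c0 n)).add (cc _ (dw.c0 n))))) (zg4.1 n) ?_
    intro x hx
    have h1 := q3 n x ⟨hx.1.le, hx.2.le⟩
    have h2 := S.eq4 n x (Or.inl hx)
    rw [(hasD2 hL (S.reg_v3 n) x (hsubo hx)).deriv, hz, ← evD _ x (hsubo hx)] at h2
    linear_combination h2 + Complex.I * ρ₂ * S.lam n * h1
      + Complex.I * ρ₂ * S.f3 n x * e1' n - S.lam n ^ 2 * ρ₂ * S.v3 n x * hI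
  have E6 : ∀ n, ∀ x ∈ Icc 0 β, -(S.lam n : ℂ) ^ 2 * ρ₁ * S.v5 n x
      - k₃ * (derivWithin (derivWithin (S.v5 n) (Icc 0 L)) (Icc 0 β) x
        - l * derivWithin (S.v1 n) (Icc 0 L) x)
      + l * k₁ * (derivWithin (S.v1 n) (Icc 0 L) x + S.v3 n x + l * S.v5 n x)
      + a₀ * (Complex.I * S.lam n * S.v5 n x)
      = ((ρ₁ * (((S.lam n : ℂ))⁻¹ ^ 4 * S.f6 n x)
      + (Complex.I * ρ₁) * (((S.lam n : ℂ))⁻¹ ^ 3 * S.f5 n x))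
      + a₀ * (((S.lam n : ℂ))⁻¹ ^ 4 * S.f5 n x)) := by
    intro n
    refine eqIcc hβ
      ((((cc _ (dw.c0 n)).sub (cc _ ((dw1.c1 n).sub (cc _ (du.c1 n))))).add
        (cc _ (((du.c1 n).add (dp.c0 n)).add (cc _ (dw.c0 n))))).add (cc _ (cc _ (dw.c0 n))))
      (((cc _ (cc _ (cf6 n))).add (cc _ (cc _ (df5.c0 n)))).add (cc _ (cc _ (df5.c0 n)))) ?_
    intro x hx
    have h1 := q5 n x ⟨hx.1.le, hx.2.le⟩
    have h2 := S.eq6 n x (Or.inl hx)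
    have hd0 : HasDerivAt (deriv (S.v5 n))
        (derivWithin (derivWithin (S.v5 n) (Icc 0 L)) (Icc 0 β) x) x := by
      refine (dw1.der n x hx).congr_of_eventuallyEq ?_
      filter_upwards [Ioo_mem_nhds hx.1 hx.2] with y hy using (evD (S.v5 n) y (hsubo hy)).symm
    have hd : HasDerivAt (fun y => deriv (S.v5 n) y - (l : ℂ) * S.v1 n y)
        (derivWithin (derivWithin (S.v5 n) (Icc 0 L)) (Icc 0 β) x
          - l * derivWithin (S.v1 n) (Icc 0 L) x) x :=
      hd0.sub ((du.der n x hx).const_mul (l : ℂ))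
    rw [hd.deriv, hz, ← evD _ x (hsubo hx), if_pos hx.2] at h2
    linear_combination h2 + Complex.I * ρ₁ * S.lam n * h1 + a₀ * h1
      + Complex.I * ρ₁ * S.f5 n x * e1' n - S.lam n ^ 2 * ρ₁ * S.v5 n x * hI
  obtain ⟨φ1, φ2, φ3, dφ, dφ1, dφ2, f10, f11, f20, f21⟩ := weights (β := β)
  exact core hβ hrho1 hrho2 hk1 hk2 hk3 hl hΛ (fun n => Complex.conj_ofReal _) hT du du1 dp dp1
    dw dw1 bu bp zw bu1 bT bw1 zg2 zg4 zg6 E2 E4 E6 dφ dφ1 dφ2 (by simp) (by simp) f10 f11 f20 f21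

theorem bresse_lemma6_H3 (ρ₁ ρ₂ k₁ k₂ k₃ l L β a₀ : ℝ) (ℓ : ℕ)
    (hrho1 : 0 < ρ₁) (hrho2 : 0 < ρ₂) (hk1 : 0 < k₁) (hk2 : 0 < k₂) (hk3 : 0 < k₃)
    (hl : 0 < l) (hL : 0 < L) (ha0 : 0 < a₀) (hbeta : 0 < β) (hbetaL : β < L)
    (S : BresseSetting ρ₁ ρ₂ k₁ k₂ k₃ l L β a₀ ℓ)
    (hH : k₁ / ρ₁ ≠ k₂ / ρ₂ ∧ ℓ = 4) :
    ∀ ε : ℝ, 0 < ε → ε < β / 12 →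
    Tendsto (fun n => ∫ x in (5 * ε)..(β - 5 * ε), ‖deriv (S.v3 n) x‖ ^ 2) atTop (nhds 0) ∧
    Tendsto (fun n => (S.lam n) ^ 2 * ∫ x in (6 * ε)..(β - 6 * ε), ‖S.v3 n x‖ ^ 2)
      atTop (nhds 0) := by
  obtain ⟨_, rfl⟩ := hH
  intro ε hε hε2
  obtain ⟨o1, o2⟩ := step3 hrho1 hrho2 hk1 hk2 hk3 hl hL ha0 hbeta hbetaL S
  have hsub : Icc 0 β ⊆ Icc 0 L := Icc_subset_Icc_right hbetaL.le
  constructor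
  · have h := extract hbeta (c := fun _ => 1) (fun _ => zero_le_one)
      (p := fun n => derivWithin (S.v3 n) (Icc 0 L))
      (fun n => (c1data hL ((S.reg_v3 n).of_le (m := 1) (by norm_num))).1.mono hsub)
      (OO.congr hbeta o2 (fun n x _ => by push_cast; ring)) (s := 5 * ε) (by linarith)
      (by linarith)
    refine h.congr fun n => ?_
    rw [one_mul]
    exact int_congr_Ioo (by linarith) fun x hx => by
      simp only [evD (a := 0) (b := L) (S.v3 n) x ⟨by linarith [hx.1], by linarith [hx.2]⟩]
  · exact extract hbeta (c := fun n => S.lam n ^ 2) (fun n => sq_nonneg _) (p := S.v3)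
      (fun n => (S.reg_v3 n).continuousOn.mono hsub)
      (OO.congr hbeta o1 (fun n x _ => by push_cast; ring)) (s := 6 * ε) (by linarith)
      (by linarith)
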